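/- arXiv:2004.13814 — 9 statements merged into one kernel-verified Lean document; each statement's English description precedes it below -/
import Mathlib

section
/- Let n ≥ 1, let 𝕂 be a field and R = 𝕂[x_1,…,x_n]. Let G be a loopless multigraph on the vertex set {0,1,…,n} given by a symmetric adjacency matrix (a_{ij})_{0≤i,j≤n} of natural numbers with zero diagonal, and assume a_{0n} ≥ 1. Let G' be the multigraph obtained from G by deleting one edge between 0 and n (i.e., a'_{0n} = a'_{n0} = a_{0n} − 1 and all other multiplicities unchanged). Then the G'-parking function ideal equals the colon ideal of the G-parking function ideal by x_n: M_{G'} = (M_G : x_n) = {z ∈ R : z·x_n ∈ M_G}. -/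
/-- `dA a A i` is the number of edges from the non-root vertex `i+1` to vertices outside
`A` (where `A` is a set of non-root vertices, `Fin n` indexing the vertices `1,…,n` of the
multigraph on `{0,1,…,n}` with adjacency matrix `a`). -/
def dA {n : ℕ} (a : Fin (n + 1) → Fin (n + 1) → ℕ) (A : Finset (Fin n)) (i : Fin n) : ℕ :=
  a i.succ 0 + ∑ j ∈ Aᶜ, a i.succ j.succ

/-- The `G`-parking function ideal of the multigraph on `{0,…,n}` with adjacency matrix `a`,
generated by the monomials `m_A = ∏_{i ∈ A} x_i ^ d_A(i)` for nonempty `A ⊆ [n]`. -/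
noncomputable def parkingIdeal {n : ℕ} (K : Type*) [Field K]
    (a : Fin (n + 1) → Fin (n + 1) → ℕ) : Ideal (MvPolynomial (Fin n) K) :=
  Ideal.span {m | ∃ A : Finset (Fin n), A.Nonempty ∧
    m = ∏ i ∈ A, MvPolynomial.X i ^ dA a A i}

/-- A polynomial lies in the parking function ideal iff each of its exponents dominates the
exponent of some generator. -/
theorem mem_parkingIdeal_iff {n : ℕ} (K : Type*) [Field K]
    (a : Fin (n + 1) → Fin (n + 1) → ℕ) (z : MvPolynomial (Fin n) K) :
    z ∈ parkingIdeal K a ↔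
      ∀ e ∈ z.support, ∃ A : Finset (Fin n), A.Nonempty ∧ ∀ i ∈ A, dA a A i ≤ e i := by
  have hgen : {m : MvPolynomial (Fin n) K | ∃ A : Finset (Fin n), A.Nonempty ∧
      m = ∏ i ∈ A, MvPolynomial.X i ^ dA a A i} =
      (fun e => MvPolynomial.monomial e (1 : K)) ''
        {e | ∃ A : Finset (Fin n), A.Nonempty ∧ e = Finsupp.indicator A fun i _ => dA a A i} := by
    have hprod (A : Finset (Fin n)) :
        ∏ i ∈ A, (MvPolynomial.X i : MvPolynomial (Fin n) K) ^ dA a A i =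
          MvPolynomial.monomial (Finsupp.indicator A fun i _ => dA a A i) 1 := by
      rw [Finsupp.indicator_eq_sum_single, MvPolynomial.monomial_sum_one]
      simp only [MvPolynomial.X_pow_eq_monomial]
    ext m
    simp only [hprod, Set.mem_image, Set.mem_ofPred_eq]
    constructor
    · rintro ⟨A, hA, rfl⟩
      exact ⟨_, ⟨A, hA, rfl⟩, rfl⟩
    · rintro ⟨_, ⟨A, hA, rfl⟩, rfl⟩
      exact ⟨A, hA, rfl⟩
  have hle (A : Finset (Fin n)) (e : Fin n →₀ ℕ) :
      (Finsupp.indicator A fun i _ => dA a A i) ≤ e ↔ ∀ i ∈ A, dA a A i ≤ e i := by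
    rw [Finsupp.le_def]
    refine forall_congr' fun i => ?_
    by_cases hi : i ∈ A <;> simp [Finsupp.indicator_apply, hi]
  rw [parkingIdeal, hgen, MvPolynomial.mem_ideal_span_monomial_image]
  refine forall₂_congr fun e _ => ?_
  constructor
  · rintro ⟨_, ⟨A, hA, rfl⟩, h⟩
    exact ⟨A, hA, (hle A e).1 h⟩
  · rintro ⟨A, hA, h⟩
    exact ⟨_, ⟨A, hA, rfl⟩, (hle A e).2 h⟩

/-- Deleting one edge between the root `0` and the vertex `n` turns the parking function
ideal `M_G` into the colon ideal `(M_G : x_n)`. -/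
theorem stmt0 (n : ℕ) (hn : 1 ≤ n) (K : Type*) [Field K]
    (a a' : Fin (n + 1) → Fin (n + 1) → ℕ)
    (hsymm : ∀ i j, a i j = a j i) (hdiag : ∀ i, a i i = 0)
    (h0n : 1 ≤ a 0 (Fin.last n))
    (ha' : ∀ i j, a' i j =
      if (i = 0 ∧ j = Fin.last n) ∨ (i = Fin.last n ∧ j = 0) then a i j - 1 else a i j) :
    ∀ z : MvPolynomial (Fin n) K,
      z ∈ parkingIdeal K a' ↔
        z * MvPolynomial.X (⟨n - 1, by omega⟩ : Fin n) ∈ parkingIdeal K a := by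
  intro z
  set N : Fin n := ⟨n - 1, by omega⟩
  have hN : N.succ = Fin.last n := by
    ext
    simp only [N, Fin.succ_mk, Fin.val_last]
    omega
  have hd (A : Finset (Fin n)) (i : Fin n) :
      dA a A i = dA a' A i + Finsupp.single N 1 i := by
    have hsum : ∑ j ∈ Aᶜ, a' i.succ j.succ = ∑ j ∈ Aᶜ, a i.succ j.succ :=
      Finset.sum_congr rfl fun j _ => by simp [ha', Fin.succ_ne_zero]
    rw [dA, dA, hsum, ha']
    by_cases hi : i = N
    · subst hi
      have h1 : 1 ≤ a (Fin.last n) 0 := hsymm 0 (Fin.last n) ▸ h0n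
      rw [hN, if_pos (Or.inr ⟨rfl, rfl⟩), Finsupp.single_eq_same]
      omega
    · have hi' : i.succ ≠ Fin.last n := fun h => hi (Fin.succ_injective n (h.trans hN.symm))
      simp [hi, hi', Fin.succ_ne_zero]
  rw [mem_parkingIdeal_iff, mem_parkingIdeal_iff, MvPolynomial.support_mul_X]
  simp only [Finset.mem_map, addRightEmbedding_apply, forall_exists_index, and_imp,
    forall_apply_eq_imp_iff₂, Finsupp.add_apply, hd, add_le_add_iff_right]
end

section
/- Let n ≥ 1 and let G be a loopless multigraph on the vertex set {0,1,…,n} with root 0, given by a symmetric adjacency matrix (a_{ij}) with zero diagonal, and assume a_{0n} ≥ 1. Let G' be obtained from G by deleting one edge between 0 and n (a'_{0n} = a_{0n} − 1, all other multiplicities unchanged). Then the map sending P : [n] → ℕ to the function P + δ_n (which agrees with P except that its value at n is P(n) + 1) is a bijection from sPF(G') onto sPF(G); in particular |sPF(G)| = |sPF(G')|. -/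
/-- The set of spherical `G`-parking functions of the multigraph on `{0,…,n}` with
adjacency matrix `a`: `P i ≥ d_{[n]}(i)` for all `i`, and for every nonempty proper
`A ⊊ [n]` there is `i ∈ A` with `P i < d_A(i)`. -/
def sPF {n : ℕ} (a : Fin (n + 1) → Fin (n + 1) → ℕ) : Set (Fin n → ℕ) :=
  {P | (∀ i, dA a Finset.univ i ≤ P i) ∧
    ∀ A : Finset (Fin n), A.Nonempty → A ≠ Finset.univ → ∃ i ∈ A, P i < dA a A i}

/-- Deleting an edge between the root and the last vertex lowers `d_A` by one at the last
vertex and changes nothing elsewhere. -/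
theorem dA_delete_root_edge {n : ℕ} {v : Fin n} (hv : v.succ = Fin.last n)
    {a a' : Fin (n + 1) → Fin (n + 1) → ℕ} (h : 1 ≤ a (Fin.last n) 0)
    (ha' : ∀ i j, a' i j =
      if (i = 0 ∧ j = Fin.last n) ∨ (i = Fin.last n ∧ j = 0) then a i j - 1 else a i j)
    (A : Finset (Fin n)) (i : Fin n) :
    dA a A i = dA a' A i + if i = v then 1 else 0 := by
  have hsum : ∑ j ∈ Aᶜ, a' i.succ j.succ = ∑ j ∈ Aᶜ, a i.succ j.succ :=
    Finset.sum_congr rfl fun j _ => by simp [ha', Fin.succ_ne_zero]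
  have hlast : i.succ = Fin.last n ↔ i = v := by rw [← hv, Fin.succ_inj]
  have hroot : a' i.succ 0 = if i.succ = Fin.last n then a i.succ 0 - 1 else a i.succ 0 := by
    simp [ha', Fin.succ_ne_zero]
  unfold dA
  rw [hsum, hroot]
  simp only [← hlast]
  split_ifs with hi
  · rw [hi]
    omega
  · rfl

/-- Raising a function and all the values `d_A` by the same amount at each vertex preserves
and reflects spherical parking functions. -/
theorem mem_sPF_iff_of_dA_eq_add {n : ℕ} {a a' : Fin (n + 1) → Fin (n + 1) → ℕ}
    {P Q e : Fin n → ℕ} (hd : ∀ A i, dA a A i = dA a' A i + e i) (hQ : ∀ i, Q i = P i + e i) :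
    Q ∈ sPF a ↔ P ∈ sPF a' := by
  simp [sPF, hd, hQ]

/-- Deleting one edge between the root `0` and the vertex `n`: the map `P ↦ P + δ_n`
is a bijection from `sPF(G')` onto `sPF(G)`; in particular `|sPF(G)| = |sPF(G')|`. -/
theorem stmt1 (n : ℕ) (hn : 1 ≤ n)
    (a a' : Fin (n + 1) → Fin (n + 1) → ℕ)
    (hsymm : ∀ i j, a i j = a j i) (hdiag : ∀ i, a i i = 0)
    (h0n : 1 ≤ a 0 (Fin.last n))
    (ha' : ∀ i j, a' i j =
      if (i = 0 ∧ j = Fin.last n) ∨ (i = Fin.last n ∧ j = 0) then a i j - 1 else a i j) :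
    Set.BijOn (fun (P : Fin n → ℕ) (i : Fin n) =>
        if i = (⟨n - 1, by omega⟩ : Fin n) then P i + 1 else P i)
      (sPF a') (sPF a) ∧
    (sPF a).ncard = (sPF a').ncard := by
  set v : Fin n := ⟨n - 1, by omega⟩
  have hv : v.succ = Fin.last n := Fin.ext (Nat.sub_add_cancel hn)
  let e : Fin n → ℕ := fun i => if i = v then 1 else 0
  have hd : ∀ A i, dA a A i = dA a' A i + e i := fun A i =>
    dA_delete_root_edge hv (hsymm 0 _ ▸ h0n) ha' A i
  have hshift : ∀ (P : Fin n → ℕ) (i : Fin n),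
      (if i = v then P i + 1 else P i) = P i + e i := fun P i => by
    simp only [e]
    split_ifs <;> rfl
  simp only [hshift]
  have hbij : Set.BijOn (fun (P : Fin n → ℕ) i => P i + e i) (sPF a') (sPF a) := by
    refine ⟨fun P hP => (mem_sPF_iff_of_dA_eq_add hd fun _ => rfl).2 hP, fun P _ P' _ h => ?_,
      fun Q hQ => ?_⟩
    · exact funext fun i => Nat.add_right_cancel (congrFun h i)
    · have hle : ∀ i, Q i - e i + e i = Q i := fun i =>
        Nat.sub_add_cancel ((Nat.le_add_left _ _).trans ((hd _ i).symm.le.trans (hQ.1 i)))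
      exact ⟨fun i => Q i - e i,
        (mem_sPF_iff_of_dA_eq_add hd fun i => (hle i).symm).1 hQ, funext hle⟩
  exact ⟨hbij, hbij.image_eq ▸ hbij.injOn.ncard_image⟩
end

section
/- Let n ≥ 2 and a, b ≥ 1 be integers, and let E be the set of all edges of K_{n+1}^{a,b} through the root 0. Let K_{n+1}^{a,b} − E be the multigraph obtained by deleting all edges through 0 (so its adjacency matrix has a_{0i} = 0 for all i ∈ [n] and b edges between each pair of distinct vertices of [n]). Then |sPF(K_{n+1}^{a,b} − E)| = |sPF(K_{n+1}^{a,b})|. -/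
/-- Adjacency matrix of the complete multigraph `K_{n+1}^{a,b}`: `a` edges between the
root `0` and each `i ∈ [n]`, `b` edges between distinct non-root vertices. -/
def Kab (n a b : ℕ) : Fin (n + 1) → Fin (n + 1) → ℕ := fun i j =>
  if i = j then 0 else if i = 0 ∨ j = 0 then a else b

/-- Adjacency matrix of `K_{n+1}^{a,b} − E`, where `E` is the set of all edges through
the root `0`. -/
def KabNoRoot (n b : ℕ) : Fin (n + 1) → Fin (n + 1) → ℕ := fun i j =>
  if i = j then 0 else if i = 0 ∨ j = 0 then 0 else b

/-- Deleting the root edges lowers every `dA` by the multiplicity of the root edges. -/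
theorem dA_Kab (n a b : ℕ) (A : Finset (Fin n)) (i : Fin n) :
    dA (Kab n a b) A i = dA (KabNoRoot n b) A i + a := by
  simp [dA, Kab, KabNoRoot, add_comm]

theorem dA_KabNoRoot_univ (n b : ℕ) (i : Fin n) :
    dA (KabNoRoot n b) Finset.univ i = 0 := by
  simp [dA, KabNoRoot]

/-- The spherical parking functions of `K_{n+1}^{a,b}` are the translates by `a` of those of the
multigraph without root edges. -/
theorem sPF_Kab_eq_image (n a b : ℕ) :
    sPF (Kab n a b) = (fun P i => P i + a) '' sPF (KabNoRoot n b) := by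
  ext P
  simp only [sPF, Set.mem_image, Set.mem_ofPred_eq, dA_Kab, dA_KabNoRoot_univ, zero_add]
  constructor
  · rintro ⟨h1, h2⟩
    refine ⟨fun i => P i - a, ⟨fun i => Nat.zero_le _, fun A hA hA' => ?_⟩,
      funext fun i => Nat.sub_add_cancel (h1 i)⟩
    obtain ⟨i, hi, h⟩ := h2 A hA hA'
    have := h1 i
    exact ⟨i, hi, by dsimp only; omega⟩
  · rintro ⟨Q, ⟨-, h2⟩, rfl⟩
    refine ⟨fun i => Nat.le_add_left _ _, fun A hA hA' => ?_⟩
    obtain ⟨i, hi, h⟩ := h2 A hA hA'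
    exact ⟨i, hi, Nat.add_lt_add_right h a⟩

/-- Deleting all edges through the root does not change the number of spherical parking
functions of `K_{n+1}^{a,b}`. -/
theorem stmt2 (n a b : ℕ) (hn : 2 ≤ n) (ha : 1 ≤ a) (hb : 1 ≤ b) :
    (sPF (KabNoRoot n b)).ncard = (sPF (Kab n a b)).ncard := by
  rw [sPF_Kab_eq_image]
  refine (Set.ncard_image_of_injective _ fun P Q h => funext fun i => ?_).symm
  exact Nat.add_right_cancel (congrFun h i)
end

section
/- For all integers n ≥ 2 and a, b ≥ 1, the number of spherical K_{n+1}^{a,b}-parking functions is |sPF(K_{n+1}^{a,b})| = b^n (n−1)^{n−1} (in particular it does not depend on a). -/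
lemma dA_univ_Kab (n a b : ℕ) (i : Fin n) : dA (Kab n a b) Finset.univ i = a := by
  simp [dA, Kab]

lemma dA_Kab_of_mem (n a b : ℕ) {A : Finset (Fin n)} {i : Fin n} (hi : i ∈ A) :
    dA (Kab n a b) A i = a + b * (n - A.card) := by
  have h : ∀ j ∈ Aᶜ, Kab n a b i.succ j.succ = b := by
    intro j hj
    have hij : i ≠ j := by
      rintro rfl
      exact Finset.mem_compl.1 hj hi
    simp [Kab, hij]
  rw [dA, Finset.sum_congr rfl h]
  simp [Kab, Finset.card_compl, mul_comm]

/-- A spherical parking function of `K_{n+1}^{a,b}` is a function with values at least `a`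
having more than `m` values below `a + b * m`, for each `1 ≤ m < n`. -/
lemma mem_sPF_Kab_iff (n a b : ℕ) (P : Fin n → ℕ) :
    P ∈ sPF (Kab n a b) ↔ (∀ i, a ≤ P i) ∧
      ∀ m, 1 ≤ m → m < n → m < (Finset.univ.filter fun i => P i < a + b * m).card := by
  simp only [sPF, Set.mem_ofPred_eq, dA_univ_Kab]
  refine and_congr_right fun _ => ⟨fun h m hm hmn => ?_, fun h A hA hAu => ?_⟩
  · by_contra! hcard
    have hc : n - m ≤ ((Finset.univ.filter fun i => P i < a + b * m)ᶜ).card := by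
      rw [Finset.card_compl, Fintype.card_fin]
      omega
    obtain ⟨A, hAs, hAc⟩ := Finset.exists_subset_card_eq hc
    have hne : A.Nonempty := Finset.card_pos.1 (by omega)
    have hnu : A ≠ Finset.univ := by
      rintro rfl
      rw [Finset.card_univ, Fintype.card_fin] at hAc
      omega
    obtain ⟨i, hi, hlt⟩ := h A hne hnu
    rw [dA_Kab_of_mem n a b hi, hAc, Nat.sub_sub_self hmn.le] at hlt
    exact Finset.mem_compl.1 (hAs hi) (by simpa using hlt)
  · by_contra! hge
    have hpos := hA.card_pos
    have hlt : A.card < n := by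
      simpa using (Finset.card_lt_iff_ne_univ A).2 hAu
    have hm := h (n - A.card) (by omega) (by omega)
    have hsub : (Finset.univ.filter fun i => P i < a + b * (n - A.card)) ⊆ Aᶜ := by
      intro i hi
      rw [Finset.mem_compl]
      intro hiA
      have := hge i hiA
      rw [dA_Kab_of_mem n a b hiA] at this
      exact absurd (Finset.mem_filter.1 hi).2 (by omega)
    have := Finset.card_le_card hsub
    rw [Finset.card_compl, Fintype.card_fin] at this
    omega

/-- Cycle lemma: if `S` increases by one over each period of length `N`, then there is exactly one
index modulo `N` after which `S` stays strictly above its value there. -/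
lemma existsUnique_forall_lt_of_add_period {N : ℕ} (hN : 0 < N) {S : ℕ → ℤ}
    (hS : ∀ m, S (m + N) = S m + 1) :
    ∃! k, k < N ∧ ∀ m, 1 ≤ m → m ≤ N → S k < S (k + m) := by
  obtain ⟨k₀, hk₀, hmin⟩ := Finset.exists_min_image (Finset.range N) S ⟨0, by simpa using hN⟩
  obtain ⟨k, hk, hmax⟩ := Finset.exists_max_image
    ((Finset.range N).filter fun k => S k = S k₀) id ⟨k₀, by simpa using hk₀⟩
  simp only [Finset.mem_filter, Finset.mem_range, id] at hk hmax hmin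
  have hgood : ∀ m, 1 ≤ m → m ≤ N → S k < S (k + m) := by
    intro m h1 hm
    by_cases hlt : k + m < N
    · rcases (hmin _ hlt).lt_or_eq with h3 | h3
      · omega
      · have := hmax _ ⟨hlt, h3.symm⟩
        omega
    · have h2 := hS (k + m - N)
      rw [Nat.sub_add_cancel (by omega)] at h2
      have := hmin (k + m - N) (by omega)
      omega
  have key : ∀ x y, x < y → y < N → (∀ m, 1 ≤ m → m ≤ N → S x < S (x + m)) →
      (∀ m, 1 ≤ m → m ≤ N → S y < S (y + m)) → False := by
    intro x y hxy hy hx' hy'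
    have h1 := hx' (y - x) (by omega) (by omega)
    have h2 := hy' (x + N - y) (by omega) (by omega)
    rw [Nat.add_sub_cancel' (by omega)] at h1 h2
    have := hS x
    omega
  refine ⟨k, ⟨hk.1, hgood⟩, ?_⟩
  rintro y ⟨hy, hy'⟩
  rcases lt_trichotomy y k with h | h | h
  · exact (key _ _ h hk.1 hy' hgood).elim
  · exact h
  · exact (key _ _ h hy hgood hy').elim

/-- Prime parking functions of length `N + 1`, with values taken in `ZMod N`. -/
def IsPrimeParking {N : ℕ} (g : Fin (N + 1) → ZMod N) : Prop :=
  ∀ m, 1 ≤ m → m ≤ N → m < (Finset.univ.filter fun i => (g i).val < m).card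

lemma card_filter_val_lt {ι : Type*} [Fintype ι] {N : ℕ} [NeZero N] (g : ι → ZMod N)
    {m : ℕ} (hm : m ≤ N) :
    (Finset.univ.filter fun i => (g i).val < m).card =
      ∑ j ∈ Finset.range m, (Finset.univ.filter fun i => g i = (j : ZMod N)).card := by
  rw [Finset.card_eq_sum_card_fiberwise (f := fun i => (g i).val) (t := Finset.range m)
    (fun i hi => by simpa using hi)]
  refine Finset.sum_congr rfl fun j hj => ?_
  congr 1
  ext i
  have hj := Finset.mem_range.1 hj
  simp only [Finset.mem_filter, Finset.mem_univ, true_and]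
  constructor
  · rintro ⟨-, rfl⟩
    simp
  · intro h
    rw [h, ZMod.val_natCast_of_lt (by omega)]
    exact ⟨hj, rfl⟩

/-- Each function has exactly one cyclic shift that is a prime parking function. -/
lemma existsUnique_isPrimeParking_sub {N : ℕ} [NeZero N] (f : Fin (N + 1) → ZMod N) :
    ∃! k : ZMod N, IsPrimeParking fun i => f i - k := by
  have hN : 0 < N := Nat.pos_of_ne_zero (NeZero.ne N)
  let c : ℕ → ℤ := fun j => ((Finset.univ.filter fun i => f i = (j : ZMod N)).card : ℤ)
  let S : ℕ → ℤ := fun m => ∑ j ∈ Finset.range m, (c j - 1)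
  have hshift : ∀ k m, m ≤ N →
      S (k + m) = S k + (Finset.univ.filter fun i => (f i - (k : ZMod N)).val < m).card - m := by
    intro k m hm
    rw [card_filter_val_lt _ hm]
    simp only [S, c, Finset.sum_range_add, sub_eq_iff_eq_add]
    push_cast
    simp only [Finset.sum_sub_distrib, add_comm (k : ZMod N)]
    simp
    ring
  have hper : ∀ m, S (m + N) = S m + 1 := by
    intro m
    rw [hshift m N le_rfl]
    simp [ZMod.val_lt]
    ring
  have hiff : ∀ k : ℕ, (IsPrimeParking fun i => f i - (k : ZMod N)) ↔
      ∀ m, 1 ≤ m → m ≤ N → S k < S (k + m) := by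
    intro k
    refine forall_congr' fun m => forall_congr' fun _ => forall_congr' fun hm => ?_
    rw [hshift k m hm]
    dsimp only
    omega
  obtain ⟨k, ⟨-, hk⟩, huniq⟩ := existsUnique_forall_lt_of_add_period hN hper
  refine ⟨k, (hiff k).2 hk, fun y hy => ?_⟩
  have hy' : IsPrimeParking fun i => f i - ((y.val : ℕ) : ZMod N) := by simpa using hy
  rw [← huniq y.val ⟨ZMod.val_lt y, (hiff _).1 hy'⟩]
  simp

lemma ncard_isPrimeParking (N : ℕ) [NeZero N] :
    {g : Fin (N + 1) → ZMod N | IsPrimeParking g}.ncard = N ^ N := by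
  have hbij : Function.Bijective
      fun x : {g : Fin (N + 1) → ZMod N | IsPrimeParking g} × ZMod N =>
        fun i => x.1.1 i + x.2 := by
    constructor
    · rintro ⟨⟨g, hg⟩, k⟩ ⟨⟨g', hg'⟩, k'⟩ h
      have hf : ∀ i, g i + k = g' i + k' := congrFun h
      have hk : k = k' := by
        refine (existsUnique_isPrimeParking_sub fun i => g i + k).unique (by simpa using hg) ?_
        simpa [hf] using hg'
      subst hk
      have : g = g' := funext fun i => add_right_cancel (hf i)
      subst this
      rfl
    · intro f
      obtain ⟨k, hk, -⟩ := existsUnique_isPrimeParking_sub f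
      exact ⟨(⟨_, hk⟩, k), by simp⟩
  have hcard := Nat.card_congr (Equiv.ofBijective _ hbij)
  rw [Nat.card_prod, Nat.card_coe_set_eq, Nat.card_fun, Nat.card_zmod, Nat.card_fin,
    pow_succ] at hcard
  exact Nat.eq_of_mul_eq_mul_right (Nat.pos_of_ne_zero (NeZero.ne N)) hcard

/-- The number of spherical `K_{n+1}^{a,b}`-parking functions is `b^n (n−1)^{n−1}`. -/
theorem stmt3 (n a b : ℕ) (hn : 2 ≤ n) (ha : 1 ≤ a) (hb : 1 ≤ b) :
    (sPF (Kab n a b)).ncard = b ^ n * (n - 1) ^ (n - 1) := by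
  obtain ⟨N, rfl⟩ : ∃ N, n = N + 1 := ⟨n - 1, by omega⟩
  have : NeZero N := ⟨by omega⟩
  let Φ : (Fin (N + 1) → ZMod N) × (Fin (N + 1) → Fin b) → Fin (N + 1) → ℕ :=
    fun x i => a + (b * (x.1 i).val + x.2 i)
  have hdiv : ∀ (q : ℕ) (r : Fin b), (b * q + r) / b = q := fun q r => by
    rw [Nat.mul_add_div hb, Nat.div_eq_of_lt r.2, add_zero]
  have hΦ : Function.Injective Φ := by
    rintro ⟨g, r⟩ ⟨g', r'⟩ h
    have h1 : ∀ i, b * (g i).val + r i = b * (g' i).val + r' i := fun i =>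
      Nat.add_left_cancel (congrFun h i)
    have hg : ∀ i, (g i).val = (g' i).val := fun i => by
      rw [← hdiv (g i).val (r i), h1, hdiv]
    refine Prod.ext (funext fun i => ZMod.val_injective N (hg i)) (funext fun i => Fin.ext ?_)
    have := h1 i
    rw [hg i] at this
    exact Nat.add_left_cancel this
  have hlt : ∀ g r i m, Φ (g, r) i < a + b * m ↔ (g i).val < m := by
    intro g r i m
    rw [Nat.add_lt_add_iff_left, mul_comm b m, ← Nat.div_lt_iff_lt_mul hb, hdiv]
  have hmem : ∀ g r, Φ (g, r) ∈ sPF (Kab (N + 1) a b) ↔ IsPrimeParking g := by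
    intro g r
    rw [mem_sPF_Kab_iff]
    simp only [hlt, IsPrimeParking, Nat.lt_succ_iff]
    exact and_iff_right fun i => Nat.le_add_right _ _
  have himage : sPF (Kab (N + 1) a b) =
      Φ '' ({g | IsPrimeParking g} ×ˢ (Set.univ : Set (Fin (N + 1) → Fin b))) := by
    ext P
    constructor
    · intro hP
      have hP' := (mem_sPF_Kab_iff _ _ _ _).1 hP
      have hcard := hP'.2 N (by omega) (by omega)
      have hall : (Finset.univ.filter fun i => P i < a + b * N) = Finset.univ := by
        apply Finset.eq_univ_of_card
        have := Finset.card_le_univ (Finset.univ.filter fun i => P i < a + b * N)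
        rw [Fintype.card_fin] at this ⊢
        omega
      have hPlt : ∀ i, P i < a + b * N := fun i =>
        (Finset.filter_eq_self.1 hall) i (Finset.mem_univ i)
      have heq : Φ (fun i => (((P i - a) / b : ℕ) : ZMod N),
          fun i => ⟨(P i - a) % b, Nat.mod_lt _ hb⟩) = P := by
        funext i
        have h1 := hPlt i
        have h2 := hP'.1 i
        have h3 : (P i - a) / b < N := by
          rw [Nat.div_lt_iff_lt_mul hb, mul_comm]
          omega
        simp only [Φ, ZMod.val_natCast_of_lt h3, Nat.div_add_mod]
        omega
      refine ⟨_, ⟨?_, Set.mem_univ _⟩, heq⟩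
      exact (hmem _ _).1 (heq ▸ hP)
    · rintro ⟨⟨g, r⟩, ⟨hg, -⟩, rfl⟩
      exact (hmem g r).2 hg
  rw [himage, Set.ncard_image_of_injective _ hΦ, Set.ncard_prod, ncard_isPrimeParking,
    Set.ncard_univ, Nat.card_fun, Nat.card_fin, Nat.card_fin, mul_comm, Nat.add_sub_cancel]
end

section
/- Let n ≥ 2 and let K_{n+1} be the complete graph on {0,1,…,n} with root 0. A function P : [n] → ℕ is a spherical K_{n+1}-parking function if and only if its non-decreasing rearrangement p_{(1)} ≤ p_{(2)} ≤ … ≤ p_{(n)} satisfies p_{(1)} = 1 and p_{(j)} < j for all 2 ≤ j ≤ n. -/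
/-- Adjacency matrix of the complete simple graph `K_{n+1}` on `{0,…,n}`. -/
def Kcomplete (n : ℕ) : Fin (n + 1) → Fin (n + 1) → ℕ := fun i j =>
  if i = j then 0 else 1

theorem dA_Kcomplete {n : ℕ} (A : Finset (Fin n)) {i : Fin n} (hi : i ∈ A) :
    dA (Kcomplete n) A i = n - A.card + 1 := by
  have hsum : ∑ j ∈ Aᶜ, Kcomplete n i.succ j.succ = ∑ _j ∈ Aᶜ, 1 := by
    refine Finset.sum_congr rfl fun j hj => ?_
    have hij : i ≠ j := by
      rintro rfl
      exact Finset.mem_compl.mp hj hi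
    simp [Kcomplete, hij]
  rw [dA, hsum, Finset.sum_const, Finset.card_compl, Fintype.card_fin]
  simp [Kcomplete, Fin.succ_ne_zero, add_comm]

theorem mem_sPF_Kcomplete_iff {n : ℕ} {P : Fin n → ℕ} :
    P ∈ sPF (Kcomplete n) ↔ (∀ i, 1 ≤ P i) ∧
      ∀ A : Finset (Fin n), A.Nonempty → A ≠ Finset.univ → ∃ i ∈ A, P i < n - A.card + 1 := by
  refine and_congr (forall_congr' fun i => ?_) (forall₃_congr fun A _ _ => ?_)
  · rw [dA_Kcomplete _ (Finset.mem_univ i)]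
    simp
  · exact exists_congr fun i => and_congr_right fun hi => by rw [dA_Kcomplete A hi]

/-- A `k`-element subset of `Fin n` contains an element that is at most `n - k`. -/
theorem Fin.exists_mem_le_sub_card {n : ℕ} {B : Finset (Fin n)} (hB : B.Nonempty) :
    ∃ j ∈ B, (j : ℕ) ≤ n - B.card := by
  by_contra! h
  obtain ⟨b, hb⟩ := hB
  have hlt : n - B.card < n := (h b hb).trans b.isLt
  have hsub : B ⊆ Finset.Ioi ⟨n - B.card, hlt⟩ := fun j hj =>
    Finset.mem_Ioi.mpr (Fin.lt_def.mpr (h j hj))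
  have hcard := Finset.card_le_card hsub
  have hpos := Finset.card_pos.mpr ⟨b, hb⟩
  rw [Fin.card_Ioi] at hcard
  simp only at hcard
  omega

/-- A function `P : [n] → ℕ` is a spherical `K_{n+1}`-parking function if and only if its
non-decreasing rearrangement `p_{(1)} ≤ … ≤ p_{(n)}` satisfies `p_{(1)} = 1` and
`p_{(j)} < j` for `2 ≤ j ≤ n`. -/
theorem stmt4 (n : ℕ) (hn : 2 ≤ n) (P : Fin n → ℕ) :
    P ∈ sPF (Kcomplete n) ↔
      ∃ σ : Equiv.Perm (Fin n), Monotone (P ∘ ⇑σ) ∧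
        P (σ ⟨0, by omega⟩) = 1 ∧
        ∀ j : Fin n, 1 ≤ (j : ℕ) → P (σ j) < (j : ℕ) + 1 := by
  rw [mem_sPF_Kcomplete_iff]
  constructor
  · rintro ⟨hpos, hA⟩
    have hmono := Tuple.monotone_sort P
    have hlt : ∀ j : Fin n, 1 ≤ (j : ℕ) → P (Tuple.sort P j) < (j : ℕ) + 1 := by
      intro j hj
      have hcard : ((Finset.Ici j).map (Tuple.sort P).toEmbedding).card = n - j := by
        rw [Finset.card_map, Fin.card_Ici]
      obtain ⟨i, hi, hPi⟩ := hA ((Finset.Ici j).map (Tuple.sort P).toEmbedding)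
        (Finset.nonempty_Ici.map) (fun h => by
          rw [h, Finset.card_univ, Fintype.card_fin] at hcard
          omega)
      obtain ⟨k, hk, rfl⟩ := Finset.mem_map.mp hi
      have hle : P (Tuple.sort P j) ≤ P (Tuple.sort P k) := hmono (Finset.mem_Ici.mp hk)
      rw [hcard] at hPi
      simp only [Equiv.coe_toEmbedding] at hPi
      omega
    refine ⟨Tuple.sort P, hmono, le_antisymm ?_ (hpos _), hlt⟩
    have hle : P (Tuple.sort P ⟨0, by omega⟩) ≤ P (Tuple.sort P ⟨1, by omega⟩) :=
      hmono (Fin.le_def.mpr (Nat.zero_le 1))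
    exact hle.trans (Nat.lt_succ_iff.mp (hlt ⟨1, by omega⟩ le_rfl))
  · rintro ⟨σ, hmono, hone, hlt⟩
    refine ⟨fun i => ?_, fun A hne huniv => ?_⟩
    · have hle : P (σ ⟨0, by omega⟩) ≤ P (σ (σ.symm i)) :=
        hmono (Fin.le_def.mpr (Nat.zero_le _))
      rwa [hone, Equiv.apply_symm_apply] at hle
    · have hcard : A.card < n := by
        simpa using Finset.card_lt_card (Finset.ssubset_univ_iff.mpr huniv)
      have hpos := hne.card_pos
      obtain ⟨j, hj, hjle⟩ :=
        Fin.exists_mem_le_sub_card (B := A.map σ.symm.toEmbedding) hne.map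
      rw [Finset.card_map] at hjle
      obtain ⟨i, hi, rfl⟩ := Finset.mem_map.mp hj
      refine ⟨i, hi, ?_⟩
      have hle : P (σ (σ.symm i)) ≤ P (σ ⟨n - A.card, by omega⟩) :=
        hmono (Fin.le_def.mpr hjle)
      rw [Equiv.apply_symm_apply] at hle
      exact hle.trans_lt (hlt ⟨n - A.card, by omega⟩ (by simp only; omega))
end

section
/- For every integer n ≥ 2 there exists a bijection φ_n from the set sPF(K_{n+1}) of spherical K_{n+1}-parking functions onto the set U_n of uprooted trees on [n] such that for every P ∈ sPF(K_{n+1}), sum(P) = C(n,2) − κ(K_n, φ_n(P)) + 1, where φ_n(P) is regarded as a spanning tree of the complete graph K_n on [n] rooted at the root of the uprooted tree φ_n(P). -/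
/-- A rooted labelled tree on the vertex set `Fin n` (representing `[n] = {1,…,n}`),
encoded by its parent function `par` and root `r`: the root is a fixed point and every
vertex reaches the root by iterating `par`. -/
def IsRootedTree {n : ℕ} (par : Fin n → Fin n) (r : Fin n) : Prop :=
  par r = r ∧ ∀ i, ∃ k, par^[k] i = r

/-- An uprooted tree on `[n]`: a rooted labelled tree whose root is bigger than all its
children (equivalently, all its neighbours). -/
def IsUprooted {n : ℕ} (par : Fin n → Fin n) (r : Fin n) : Prop :=
  IsRootedTree par r ∧ ∀ i, par i = r → i ≠ r → i < r

/-- The set `U_n` of uprooted trees on `[n]`, encoded as pairs (parent function, root). -/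
def Un (n : ℕ) : Set ((Fin n → Fin n) × Fin n) := {p | IsUprooted p.1 p.2}

/-- `i` is an ancestor of `j` in the rooted tree with parent function `par`. -/
def IsAncestor {n : ℕ} (par : Fin n → Fin n) (i j : Fin n) : Prop :=
  i ≠ j ∧ ∃ k, par^[k] j = i

/-- The κ-number `κ(K_n, T)` of a spanning tree `T` of the complete graph on `[n]` with
parent function `par` and root `r`: the number of pairs `(i,j)` with `i` an ancestor of
`j`, `i > j`, `i ≠ r` and `par i ≠ j`. -/
noncomputable def kappa {n : ℕ} (par : Fin n → Fin n) (r : Fin n) : ℕ :=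
  {p : Fin n × Fin n | IsAncestor par p.1 p.2 ∧ p.2 < p.1 ∧ p.1 ≠ r ∧ par p.1 ≠ p.2}.ncard

namespace DepthFirst

open Finset

section Tree

variable {V : Type*}

/-- `L` is a stack of distinct edges from burnt vertices to the unburnt set `U`. -/
structure IsState (L : List (V × V)) (U : Finset V) : Prop where
  nodup : L.Nodup
  burnt : ∀ e ∈ L, e.1 ∉ U
  unburnt : ∀ e ∈ L, e.2 ∈ U

/-- No vertex outside `U` has its parent in `U`. -/
def IsClosed (U : Finset V) (T : V → V) : Prop :=
  ∀ x ∉ U, T x ∉ U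

/-- `T` restricts to a spanning forest of `U` that hangs from edges in `L`. -/
structure IsForest (L : List (V × V)) (U : Finset V) (T : V → V) : Prop where
  mem : ∀ x ∈ U, T x ∈ U ∨ (T x, x) ∈ L
  escape : ∀ x ∈ U, ∃ k, T^[k] x ∉ U

/-- `c` lies on the path from `x` along parents, `x` itself included. -/
def IsAbove (T : V → V) (c x : V) : Prop :=
  ∃ k, T^[k] x = c

variable {i j : V} {L : List (V × V)} {U : Finset V} {T : V → V}

lemma IsState.tail {e : V × V} (h : IsState (e :: L) U) : IsState L U :=
  ⟨h.nodup.of_cons, fun a ha => h.burnt a (.tail _ ha), fun a ha => h.unburnt a (.tail _ ha)⟩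

lemma isForest_tail (hT : T j ≠ i) : IsForest L U T ↔ IsForest ((i, j) :: L) U T := by
  refine ⟨fun h => ⟨fun x hx => (h.mem x hx).imp_right (.tail _), h.escape⟩,
    fun h => ⟨fun x hx => (h.mem x hx).imp_right fun h' => ?_, h.escape⟩⟩
  refine (List.mem_cons.1 h').resolve_left fun h'' => hT ?_
  obtain ⟨h₁, rfl⟩ := Prod.ext_iff.1 h''
  exact h₁

lemma IsAbove.trans {a b c : V} (hab : IsAbove T a b) (hbc : IsAbove T b c) : IsAbove T a c := by
  obtain ⟨k, rfl⟩ := hab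
  obtain ⟨l, rfl⟩ := hbc
  exact ⟨k + l, Function.iterate_add_apply _ _ _ _⟩

lemma IsClosed.iterate (hU : IsClosed U T) {x : V} (hx : x ∉ U) (k : ℕ) : T^[k] x ∉ U :=
  (show Set.MapsTo T (U : Set V)ᶜ (U : Set V)ᶜ from hU).iterate k hx

lemma IsClosed.eq_of_isAbove (hU : IsClosed U T) {c x : V} (hx : T x ∉ U) (hc : c ∈ U)
    (h : IsAbove T c x) : c = x := by
  obtain ⟨_ | k, rfl⟩ := h
  · rfl
  · exact absurd hc (hU.iterate hx k)

lemma IsClosed.escape_unique (hU : IsClosed U T) {c c' x : V} (hc : c ∈ U) (hc' : c' ∈ U)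
    (hTc : T c ∉ U) (hTc' : T c' ∉ U) (h : IsAbove T c x) (h' : IsAbove T c' x) : c = c' := by
  obtain ⟨k, rfl⟩ := h
  obtain ⟨k', rfl⟩ := h'
  rcases le_total k k' with hk | hk
  · refine (hU.eq_of_isAbove hTc hc' ⟨k' - k, ?_⟩).symm
    rw [← Function.iterate_add_apply, Nat.sub_add_cancel hk]
  · refine hU.eq_of_isAbove hTc' hc ⟨k - k', ?_⟩
    rw [← Function.iterate_add_apply, Nat.sub_add_cancel hk]

lemma IsForest.exists_isAbove (h : IsForest L U T) {x : V} (hx : x ∈ U) :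
    ∃ c, IsAbove T c x ∧ c ∈ U ∧ T c ∉ U := by
  classical
  obtain ⟨k, hk⟩ := Nat.exists_not_and_succ_of_not_zero_of_exists
    (p := fun k => T^[k] x ∉ U) (by simpa using hx) (h.escape x hx)
  exact ⟨T^[k] x, ⟨k, rfl⟩, not_not.1 hk.1, by simpa [Function.iterate_succ_apply'] using hk.2⟩

end Tree

variable {V : Type*} [LinearOrder V]

/-- The edges from `j` to the vertices of `S`, the largest endpoint first. -/
def fan (j : V) (S : Finset V) : List (V × V) :=
  (S.sort (· ≥ ·)).map (Prod.mk j)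

/-- The stack of pending edges after the vertex `j` of the unburnt set `U` has caught fire. -/
def fire (j : V) (L : List (V × V)) (U : Finset V) : List (V × V) :=
  fan j (U.erase j) ++ L.filter (fun e => e.2 ≠ j)

/-- The number of edges in `L` that end in `x`. -/
def inDegree (L : List (V × V)) (x : V) : ℕ :=
  L.countP (fun e => e.2 = x)

/-- `Burn L U p T`: depth-first burning of the unburnt set `U` along the stack `L`, where `p`
counts the attempts that each vertex resists, burns all of `U` along the edges of `T`. -/
inductive Burn : List (V × V) → Finset V → (V → ℕ) → (V → V) → Prop
  | nil (p : V → ℕ) (T : V → V) : Burn [] ∅ p T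
  | burn {i j : V} {L : List (V × V)} {U : Finset V} {p : V → ℕ} {T : V → V} (hp : p j = 0)
      (hT : T j = i) (h : Burn (fire j L U) (U.erase j) p T) : Burn ((i, j) :: L) U p T
  | damp {i j : V} {L : List (V × V)} {U : Finset V} {p : V → ℕ} {T : V → V} (hp : p j ≠ 0)
      (hT : T j ≠ i) (h : Burn L U (Function.update p j (p j - 1)) T) : Burn ((i, j) :: L) U p T

/-- Parking functions on `U`, whose vertices are pairwise adjacent and are joined to the
outside by the edges in `L`. -/
def IsParking (L : List (V × V)) (U : Finset V) (p : V → ℕ) : Prop :=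
  ∀ A ⊆ U, A.Nonempty → ∃ x ∈ A, p x < inDegree L x + (U \ A).card

@[simp]
lemma mem_fan {j : V} {S : Finset V} {e : V × V} : e ∈ fan j S ↔ e.1 = j ∧ e.2 ∈ S := by
  obtain ⟨a, b⟩ := e
  simp [fan, and_comm, eq_comm]

lemma mem_fire {j : V} {L : List (V × V)} {U : Finset V} {e : V × V} :
    e ∈ fire j L U ↔ (e.1 = j ∧ e.2 ∈ U.erase j) ∨ (e ∈ L ∧ e.2 ≠ j) := by
  simp [fire]

lemma nodup_fan (j : V) (S : Finset V) : (fan j S).Nodup :=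
  (S.sort_nodup _).map (Prod.mk_right_injective j)

@[simp]
lemma length_fan (j : V) (S : Finset V) : (fan j S).length = S.card := by
  simp [fan]

lemma inDegree_fan (j : V) (S : Finset V) (x : V) :
    inDegree (fan j S) x = if x ∈ S then 1 else 0 := by
  have h := (S.sort_nodup (· ≥ ·)).count (a := x)
  simp only [mem_sort] at h
  rw [← h, inDegree, fan, List.countP_map, List.count]
  congr 1

lemma inDegree_cons (i j : V) (L : List (V × V)) (x : V) :
    inDegree ((i, j) :: L) x = inDegree L x + if j = x then 1 else 0 := by
  simp [inDegree, List.countP_cons]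

lemma inDegree_fire {j x : V} (L : List (V × V)) {U : Finset V} (hx : x ∈ U.erase j) :
    inDegree (fire j L U) x = inDegree L x + 1 := by
  have h : inDegree (L.filter (fun e => e.2 ≠ j)) x = inDegree L x := by
    rw [inDegree, List.countP_filter, inDegree]
    congr 1
    ext e
    have := ne_of_mem_erase hx
    grind
  rw [← h, add_comm]
  have h' := inDegree_fan j (U.erase j) x
  rw [if_pos hx] at h'
  rw [← h', fire, inDegree, List.countP_append]
  rfl

lemma length_fire {j : V} {L : List (V × V)} {U : Finset V} :
    (fire j L U).length + inDegree L j = (U.erase j).card + L.length := by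
  have h := List.length_eq_countP_add_countP (fun e : V × V => decide (e.2 = j)) (l := L)
  rw [fire, List.length_append, length_fan, ← List.countP_eq_length_filter, inDegree]
  simp only [decide_eq_true_eq, ne_eq] at h ⊢
  omega

namespace IsState

variable {i j : V} {L : List (V × V)} {U : Finset V}

lemma fire (h : IsState ((i, j) :: L) U) : IsState (fire j L U) (U.erase j) := by
  have hj : j ∈ U := h.unburnt _ List.mem_cons_self
  refine ⟨(nodup_fan _ _).append (h.nodup.of_cons.filter _) ?_, ?_, ?_⟩
  · intro e he he'
    have := h.tail.burnt e (List.mem_of_mem_filter he')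
    rw [mem_fan] at he
    exact this (he.1 ▸ hj)
  · intro e he
    rcases mem_fire.1 he with he | he
    · simp [he.1]
    · exact fun h' => h.tail.burnt e he.1 (mem_of_mem_erase h')
  · intro e he
    rcases mem_fire.1 he with he | he
    · exact he.2
    · exact mem_erase.2 ⟨he.2, h.tail.unburnt e he.1⟩

/-- Induction along the two possible moves of depth-first burning. -/
theorem induction {motive : List (V × V) → Finset V → Prop} (nil : ∀ U, motive [] U)
    (cons : ∀ i j L U, IsState ((i, j) :: L) U →
      motive (DepthFirst.fire j L U) (U.erase j) → motive L U → motive ((i, j) :: L) U) :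
    ∀ L U, IsState L U → motive L U
  | [], U, _ => nil U
  | (i, j) :: L, U, h =>
    cons i j L U h (induction nil cons _ _ h.fire) (induction nil cons _ _ h.tail)
  termination_by L U => (U.card, L.length)
  decreasing_by
    · exact Prod.Lex.left _ _ (card_erase_lt_of_mem (h.unburnt _ List.mem_cons_self))
    · exact Prod.Lex.right _ (by simp)

end IsState

section Forest

variable {i j : V} {L : List (V × V)} {U : Finset V} {T : V → V}

lemma isForest_fire (hs : IsState ((i, j) :: L) U) (hT : T j = i) :
    IsForest (fire j L U) (U.erase j) T ↔ IsForest ((i, j) :: L) U T := by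
  have hj : j ∈ U := hs.unburnt _ List.mem_cons_self
  have hi : i ∉ U := hs.burnt _ List.mem_cons_self
  constructor
  · intro h
    refine ⟨fun x hx => ?_, fun x hx => ?_⟩
    · rcases eq_or_ne x j with rfl | hxj
      · exact .inr (by simp [hT])
      · rcases h.mem x (mem_erase.2 ⟨hxj, hx⟩) with h' | h'
        · exact .inl (mem_of_mem_erase h')
        · rcases mem_fire.1 h' with h' | h'
          · exact .inl ((show T x = j from h'.1) ▸ hj)
          · exact .inr (.tail _ h'.1)
    · rcases eq_or_ne x j with rfl | hxj
      · exact ⟨1, by simpa [hT] using hi⟩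
      · obtain ⟨k, hk⟩ := h.escape x (mem_erase.2 ⟨hxj, hx⟩)
        by_cases hkj : T^[k] x = j
        · exact ⟨k + 1, by rwa [Function.iterate_succ_apply', hkj, hT]⟩
        · exact ⟨k, fun h' => hk (mem_erase.2 ⟨hkj, h'⟩)⟩
  · intro h
    refine ⟨fun x hx => ?_, fun x hx => ?_⟩
    · have hxj := ne_of_mem_erase hx
      by_cases hTj : T x = j
      · exact .inr (mem_fire.2 (.inl ⟨hTj, hx⟩))
      · rcases h.mem x (mem_of_mem_erase hx) with h' | h'
        · exact .inl (mem_erase.2 ⟨hTj, h'⟩)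
        · refine .inr (mem_fire.2 (.inr ⟨?_, hxj⟩))
          exact (List.mem_cons.1 h').resolve_left fun h'' => hxj (Prod.ext_iff.1 h'').2
    · obtain ⟨k, hk⟩ := h.escape x (mem_of_mem_erase hx)
      exact ⟨k, fun h' => hk (mem_of_mem_erase h')⟩

lemma Burn.isForest {p : V → ℕ} (h : Burn L U p T) (hs : IsState L U) : IsForest L U T := by
  induction h with
  | nil => exact ⟨by simp, by simp⟩
  | burn _ hT _ ih => exact (isForest_fire hs hT).1 (ih hs.fire)
  | damp _ hT _ ih => exact (isForest_tail hT).1 (ih hs.tail)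

theorem exists_burn_of_isForest (hs : IsState L U) (hT : IsForest L U T) (p₀ : V → ℕ) :
    ∃ p, (∀ x ∉ U, p x = p₀ x) ∧ Burn L U p T := by
  revert p₀
  refine IsState.induction (motive := fun L U => IsForest L U T → ∀ p₀ : V → ℕ,
    ∃ p, (∀ x ∉ U, p x = p₀ x) ∧ Burn L U p T) ?_ ?_ L U hs hT
  · intro U hT p₀
    obtain rfl : U = ∅ := by
      refine eq_empty_of_forall_notMem fun x hx => ?_
      obtain ⟨k, hk⟩ := hT.escape x hx
      have hmaps : Set.MapsTo T U U := fun y hy => (hT.mem y hy).resolve_right (by simp)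
      exact hk (hmaps.iterate k hx)
    exact ⟨p₀, fun _ _ => rfl, .nil _ _⟩
  · intro i j L U hs ih₁ ih₂ hT p₀
    have hj : j ∈ U := hs.unburnt _ List.mem_cons_self
    by_cases hTj : T j = i
    · obtain ⟨p, hp, hB⟩ := ih₁ ((isForest_fire hs hTj).2 hT) (Function.update p₀ j 0)
      refine ⟨p, fun x hx => ?_, .burn (by simpa using hp j) hTj hB⟩
      rw [hp x (fun h => hx (mem_of_mem_erase h)), Function.update_of_ne]
      exact fun h => hx (h ▸ hj)
    · obtain ⟨p, hp, hB⟩ := ih₂ ((isForest_tail hTj).2 hT) p₀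
      refine ⟨Function.update p j (p j + 1), fun x hx => ?_, .damp (by simp) hTj (by simpa)⟩
      rw [Function.update_of_ne, hp x hx]
      exact fun h => hx (h ▸ hj)

end Forest

section Parking

variable {i j : V} {L : List (V × V)} {U : Finset V} {p : V → ℕ}

lemma isParking_fire (hj : j ∈ U) (hp : p j = 0) :
    IsParking (fire j L U) (U.erase j) p ↔ IsParking ((i, j) :: L) U p := by
  have key (A : Finset V) (hA : A ⊆ U.erase j) (x : V) (hx : x ∈ A) :
      inDegree (fire j L U) x + (U.erase j \ A).card =
        inDegree ((i, j) :: L) x + (U \ A).card := by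
    have hjA : j ∉ A := fun h => by simpa using hA h
    have h1 : U.erase j \ A = (U \ A).erase j := by grind
    have h2 := card_erase_add_one (mem_sdiff.2 ⟨hj, hjA⟩)
    have h3 : j ≠ x := fun h => hjA (h ▸ hx)
    rw [inDegree_fire L (hA hx), inDegree_cons, h1, ← h2, if_neg h3]
    omega
  constructor
  · intro h A hA hne
    by_cases hjA : j ∈ A
    · refine ⟨j, hjA, ?_⟩
      rw [inDegree_cons, if_pos rfl]
      omega
    · have hA' : A ⊆ U.erase j := subset_erase.2 ⟨hA, hjA⟩
      obtain ⟨x, hx, hlt⟩ := h A hA' hne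
      exact ⟨x, hx, key A hA' x hx ▸ hlt⟩
  · intro h A hA hne
    obtain ⟨x, hx, hlt⟩ := h A (hA.trans (erase_subset _ _)) hne
    exact ⟨x, hx, key A hA x hx ▸ hlt⟩

lemma isParking_update (hp : p j ≠ 0) :
    IsParking L U (Function.update p j (p j - 1)) ↔ IsParking ((i, j) :: L) U p := by
  refine forall_congr' fun A => forall_congr' fun _ => forall_congr' fun _ =>
    exists_congr fun x => and_congr_right fun _ => ?_
  rw [inDegree_cons]
  rcases eq_or_ne j x with rfl | hx
  · rw [Function.update_self, if_pos rfl]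
    omega
  · rw [Function.update_of_ne hx.symm, if_neg hx]
    omega

lemma Burn.isParking {T : V → V} (h : Burn L U p T) (hs : IsState L U) : IsParking L U p := by
  induction h with
  | nil => exact fun A hA hne => absurd (subset_empty.1 hA) hne.ne_empty
  | burn hp _ _ ih =>
    exact (isParking_fire (hs.unburnt _ List.mem_cons_self) hp).1 (ih hs.fire)
  | damp hp _ _ ih => exact (isParking_update hp).1 (ih hs.tail)

theorem exists_burn_of_isParking (hs : IsState L U) (hp : IsParking L U p) (T₀ : V → V) :
    ∃ T, (∀ x ∉ U, T x = T₀ x) ∧ Burn L U p T := by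
  revert p T₀
  refine IsState.induction (motive := fun L U => ∀ {p : V → ℕ}, IsParking L U p → ∀ T₀ : V → V,
    ∃ T, (∀ x ∉ U, T x = T₀ x) ∧ Burn L U p T) ?_ ?_ L U hs
  · intro U p hp T₀
    obtain rfl : U = ∅ := by
      by_contra hne
      obtain ⟨x, -, hx⟩ := hp U Subset.rfl (nonempty_iff_ne_empty.2 hne)
      simp [inDegree] at hx
    exact ⟨T₀, fun _ _ => rfl, .nil _ _⟩
  · intro i j L U hs ih₁ ih₂ p hp T₀
    have hj : j ∈ U := hs.unburnt _ List.mem_cons_self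
    have hi : i ∉ U := hs.burnt _ List.mem_cons_self
    by_cases hpj : p j = 0
    · obtain ⟨T, hT, hB⟩ := ih₁ ((isParking_fire hj hpj).2 hp) (Function.update T₀ j i)
      refine ⟨T, fun x hx => ?_, .burn hpj (by simpa using hT j) hB⟩
      rw [hT x (fun h => hx (mem_of_mem_erase h)), Function.update_of_ne]
      exact fun h => hx (h ▸ hj)
    · obtain ⟨T, hT, hB⟩ := ih₂ ((isParking_update hpj).2 hp) T₀
      refine ⟨T, hT, .damp hpj (fun hTj => ?_) hB⟩
      rcases (hB.isForest hs.tail).mem j hj with h | h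
      · exact hi (hTj ▸ h)
      · exact (List.nodup_cons.1 hs.nodup).1 (hTj ▸ h)

end Parking

section Unique

variable {L : List (V × V)} {U : Finset V}

lemma Burn.forest_unique {p : V → ℕ} {T T' : V → V} (h : Burn L U p T) (h' : Burn L U p T')
    (x : V) (hx : x ∈ U) : T x = T' x := by
  induction h with
  | nil => simp at hx
  | @burn i j L U p T hp hT _ ih =>
    cases h' with
    | burn _ hT' h' =>
      rcases eq_or_ne x j with rfl | hxj
      · rw [hT, hT']
      · exact ih h' (mem_erase.2 ⟨hxj, hx⟩)
    | damp hp' => exact absurd hp hp'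
  | damp hp _ _ ih =>
    cases h' with
    | burn hp' => exact absurd hp' hp
    | damp _ _ h' => exact ih h' hx

lemma Burn.parking_unique {p p' : V → ℕ} {T : V → V} (h : Burn L U p T) (h' : Burn L U p' T)
    (x : V) (hx : x ∈ U) : p x = p' x := by
  induction h generalizing p' with
  | nil => simp at hx
  | @burn i j L U p T hp hT _ ih =>
    cases h' with
    | burn hp' _ h' =>
      rcases eq_or_ne x j with rfl | hxj
      · rw [hp, hp']
      · exact ih h' (mem_erase.2 ⟨hxj, hx⟩)
    | damp _ hT' => exact absurd hT hT'
  | @damp i j L U p T hp hT _ ih =>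
    cases h' with
    | burn _ hT' => exact absurd hT' hT
    | damp hp' _ h' =>
      have := ih h' hx
      rcases eq_or_ne x j with rfl | hxj
      · simp only [Function.update_self] at this
        omega
      · rwa [Function.update_of_ne hxj, Function.update_of_ne hxj] at this

end Unique

section Skip

/-- The edge `e` leads from the parent of a non-root vertex `c` to a smaller descendant of `c`. -/
def IsSkipped (r : V) (T : V → V) (e : V × V) : Prop :=
  ∃ c, T c = e.1 ∧ c ≠ r ∧ IsAbove T c e.2 ∧ e.2 < c

/-- A stack edge is skipped exactly if its end is burnt by way of an earlier stack edge. -/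
structure IsOrdered (r : V) (T : V → V) (L : List (V × V)) : Prop where
  used : ∀ e ∈ L, T e.2 = e.1 → ¬ IsSkipped r T e
  pairwise : L.Pairwise fun a b =>
    (T a.2 = a.1 → IsAbove T a.2 b.2 → IsSkipped r T b) ∧
      (T b.2 = b.1 → IsAbove T b.2 a.2 → ¬ IsSkipped r T a)

open Classical in
/-- The skipped edges among the stack `L` and the edges inside `U`. -/
noncomputable def skipped [Fintype V] (r : V) (T : V → V) (L : List (V × V)) (U : Finset V) :
    Finset (V × V) :=
  univ.filter fun e => IsSkipped r T e ∧ e.2 ∈ U ∧ (e.1 ∈ U ∨ e ∈ L)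

variable {r i j : V} {L : List (V × V)} {U : Finset V} {T : V → V}

namespace IsClosed

lemma erase (hU : IsClosed U T) (hj : T j ∉ U) : IsClosed (U.erase j) T := by
  intro x hx h
  rcases eq_or_ne x j with rfl | hxj
  · exact hj (mem_of_mem_erase h)
  · exact hU x (fun hx' => hx (mem_erase.2 ⟨hxj, hx'⟩)) (mem_of_mem_erase h)

lemma isOrdered_fan (hU : IsClosed U T) (hr : r ∉ U) (hj : j ∉ U)
    (hch : ∀ c, T c = j → c ≠ r → c ∈ U) {S : Finset V} (hS : S ⊆ U) :
    IsOrdered r T (fan j S) := by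
  have key {c x : V} (hx : x ∈ S) (hTx : T x = j) (hxc : IsAbove T x c)
      (hc : IsSkipped r T (j, c)) : c < x := by
    obtain ⟨c', hTc', hc'r, hc'c, hlt⟩ := hc
    rwa [hU.escape_unique (hS hx) (hch c' hTc' hc'r) (hTx ▸ hj) (by rwa [hTc']) hxc hc'c]
  refine ⟨?_, ?_⟩
  · rintro ⟨a, x⟩ he hT hs
    obtain ⟨rfl, hx⟩ := mem_fan.1 he
    exact (key hx hT ⟨0, rfl⟩ hs).false
  · refine List.pairwise_map.2 (((S.pairwise_sort (· ≥ ·)).and (S.sort_nodup _)).imp_of_mem ?_)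
    intro x y hx hy hxy
    rw [mem_sort] at hx hy
    refine ⟨fun hT hxy' => ⟨x, hT, fun h => hr (h ▸ hS hx), hxy', hxy.1.lt_of_ne hxy.2.symm⟩,
      fun hT hyx hs => ?_⟩
    exact (key hy hT hyx hs).not_ge hxy.1

end IsClosed

namespace IsOrdered

lemma tail {e : V × V} (h : IsOrdered r T (e :: L)) : IsOrdered r T L :=
  ⟨fun a ha => h.used a (.tail _ ha), h.pairwise.of_cons⟩

lemma fire (h : IsOrdered r T ((i, j) :: L)) (hs : IsState ((i, j) :: L) U) (hU : IsClosed U T)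
    (hr : r ∉ U) (hT : T j = i) : IsOrdered r T (fire j L U) := by
  have hj : j ∈ U := hs.unburnt _ List.mem_cons_self
  have hi : i ∉ U := hs.burnt _ List.mem_cons_self
  have hch : ∀ c, T c = j → c ≠ r → c ∈ U.erase j := by
    refine fun c hc _ => mem_erase.2 ⟨?_, ?_⟩
    · rintro rfl
      exact hi (hT ▸ hc.symm ▸ hj)
    · by_contra hcU
      exact hU c hcU (hc ▸ hj)
  have hfan := (hU.erase (hT ▸ hi)).isOrdered_fan (S := U.erase j)
    (fun h => hr (mem_of_mem_erase h)) (notMem_erase j U) hch Subset.rfl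
  refine ⟨fun e he => ?_, List.pairwise_append.2
    ⟨hfan.pairwise, h.tail.pairwise.filter _, fun a ha b hb => ⟨fun hTa hab => ?_, ?_⟩⟩⟩
  · rcases List.mem_append.1 he with he | he
    · exact hfan.used e he
    · exact h.used e (.tail _ (List.mem_of_mem_filter he))
  · rw [mem_fan] at ha
    refine ((List.pairwise_cons.1 h.pairwise).1 b (List.mem_of_mem_filter hb)).1 hT ?_
    exact IsAbove.trans ⟨1, hTa.trans ha.1⟩ hab
  · rintro hTb hba ⟨c, hTc, hcr, hca, -⟩
    rw [mem_fan] at ha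
    rw [List.mem_filter, decide_eq_true_eq] at hb
    refine hb.2 (hU.escape_unique (hs.tail.unburnt b hb.1) hj ?_ (hT ▸ hi) hba ?_)
    · rw [hTb]
      exact hs.tail.burnt b hb.1
    · exact IsAbove.trans ⟨1, hTc.trans ha.1⟩ hca

end IsOrdered

variable [Fintype V]

lemma skipped_tail (h : IsOrdered r T ((i, j) :: L)) (hs : IsState ((i, j) :: L) U)
    (hf : IsForest ((i, j) :: L) U T) (hT : T j ≠ i) :
    skipped r T ((i, j) :: L) U = skipped r T L U := by
  have hj : j ∈ U := hs.unburnt _ List.mem_cons_self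
  obtain ⟨c, hcj, hc, hTc⟩ := hf.exists_isAbove hj
  have hcL : (T c, c) ∈ L := by
    refine (List.mem_cons.1 ((hf.mem c hc).resolve_left hTc)).resolve_left fun h' => hT ?_
    obtain ⟨h₁, rfl⟩ := Prod.ext_iff.1 h'
    exact h₁
  have hij : ¬ IsSkipped r T (i, j) :=
    ((List.pairwise_cons.1 h.pairwise).1 _ hcL).2 rfl hcj
  ext e
  simp only [skipped, mem_filter, mem_univ, true_and, List.mem_cons]
  grind

lemma card_skipped_fire (h : IsOrdered r T ((i, j) :: L)) (hs : IsState ((i, j) :: L) U)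
    (hU : IsClosed U T) (hT : T j = i) :
    (skipped r T ((i, j) :: L) U).card =
      (skipped r T (fire j L U) (U.erase j)).card + inDegree L j := by
  have hj : j ∈ U := hs.unburnt _ List.mem_cons_self
  have hi : i ∉ U := hs.burnt _ List.mem_cons_self
  have hcard : inDegree L j = (L.filter (fun e => e.2 = j)).toFinset.card := by
    rw [List.toFinset_card_of_nodup (hs.tail.nodup.filter _), inDegree,
      List.countP_eq_length_filter]
  rw [hcard, ← card_union_of_disjoint]
  · congr 1
    ext e
    have h₁ : e ∈ L → e.2 = j → IsSkipped r T e := fun he hej =>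
      ((List.pairwise_cons.1 h.pairwise).1 e he).1 hT ⟨0, hej⟩
    have h₂ : e = (i, j) → ¬ IsSkipped r T e := fun he =>
      he ▸ h.used _ List.mem_cons_self hT
    have h₃ : IsSkipped r T e → e.2 = j → e.1 ∉ U := by
      rintro ⟨c, hTc, -, hce, hlt⟩ hej heU
      have hc : c ∈ U := by
        by_contra hc
        exact hU c hc (hTc ▸ heU)
      exact hlt.ne (hej.trans (hU.eq_of_isAbove (hT ▸ hi) hc (hej ▸ hce)).symm)
    simp only [skipped, mem_union, mem_filter, mem_univ, true_and, mem_fire, List.mem_toFinset,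
      List.mem_filter, decide_eq_true_eq, List.mem_cons, mem_erase]
    grind
  · refine disjoint_left.2 fun e he he' => ?_
    simp only [skipped, mem_filter, mem_univ, true_and, mem_erase] at he
    simp only [List.mem_toFinset, List.mem_filter, decide_eq_true_eq] at he'
    exact he.2.1.1 he'.2

theorem Burn.sum_add_card_skipped {p : V → ℕ} (hB : Burn L U p T) (hs : IsState L U)
    (hU : IsClosed U T) (hr : r ∉ U) (ho : IsOrdered r T L) :
    ∑ x ∈ U, p x + (skipped r T L U).card + U.card = L.length + U.card.choose 2 := by
  induction hB with
  | nil => simp [skipped]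
  | @burn i j L U p T hp hT hB ih =>
    have hj : j ∈ U := hs.unburnt _ List.mem_cons_self
    have hi : i ∉ U := hs.burnt _ List.mem_cons_self
    have := ih hs.fire (hU.erase (hT ▸ hi)) (fun h => hr (mem_of_mem_erase h))
      (ho.fire hs hU hr hT)
    have hlen := length_fire (j := j) (L := L) (U := U)
    have hsum := add_sum_erase U p hj
    have hcard := card_erase_add_one hj
    rw [card_skipped_fire ho hs hU hT, ← hcard, Nat.choose_succ_succ', Nat.choose_one_right,
      List.length_cons, one_add_one_eq_two]
    omega
  | @damp i j L U p T hp hT hB ih =>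
    have hj : j ∈ U := hs.unburnt _ List.mem_cons_self
    have := ih hs.tail hU hr ho.tail
    have hsum := add_sum_erase U p hj
    rw [sum_update_of_mem hj, sdiff_singleton_eq_erase] at this
    rw [skipped_tail ho hs ((isForest_tail hT).1 (hB.isForest hs.tail)) hT, List.length_cons]
    omega

end Skip

section Complete

variable {n : ℕ} {P : Fin n → ℕ} {T : Fin n → Fin n} {r : Fin n}

lemma dA_Kcomplete {A : Finset (Fin n)} {i : Fin n} (hi : i ∈ A) :
    dA (Kcomplete n) A i = 1 + Aᶜ.card := by
  have h : ∀ j ∈ Aᶜ, Kcomplete n i.succ j.succ = 1 := by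
    intro j hj
    rw [Kcomplete, if_neg]
    rintro h
    exact mem_compl.1 hj (Fin.succ_injective _ h ▸ hi)
  rw [dA, sum_congr rfl h, sum_const, smul_eq_mul, mul_one, Kcomplete, if_neg (Fin.succ_ne_zero i)]

lemma mem_sPF_Kcomplete : P ∈ sPF (Kcomplete n) ↔ (∀ i, 1 ≤ P i) ∧
    ∀ A : Finset (Fin n), A.Nonempty → A ≠ univ → ∃ i ∈ A, P i < 1 + Aᶜ.card := by
  refine and_congr (forall_congr' fun i => ?_) (forall_congr' fun A => forall_congr' fun _ =>
    forall_congr' fun _ => exists_congr fun i => and_congr_right fun hi => ?_)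
  · rw [dA_Kcomplete (mem_univ i), compl_univ, card_empty, add_zero]
  · rw [dA_Kcomplete hi]

/-- The parking function on the vertices other than `r` that `P` induces when the edges from `r`
to larger vertices are deleted. -/
def reduce (r : Fin n) (P : Fin n → ℕ) (i : Fin n) : ℕ :=
  P i - 1 - if r < i then 1 else 0

/-- Depth-first burning from `r`, the largest vertex at which `P` is minimal, produces `T`. -/
structure IsBurning (P : Fin n → ℕ) (T : Fin n → Fin n) (r : Fin n) : Prop where
  root : T r = r
  one_le : ∀ i, 1 ≤ P i
  eq_one : P r = 1
  two_le : ∀ i, r < i → 2 ≤ P i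
  burn : Burn (fan r (Iio r)) (univ.erase r) (reduce r P) T

lemma isState_root (r : Fin n) : IsState (fan r (Iio r)) (univ.erase r) := by
  refine ⟨nodup_fan _ _, fun e he => ?_, fun e he => ?_⟩
  · simp [(mem_fan.1 he).1]
  · simpa using (mem_Iio.1 (mem_fan.1 he).2).ne

lemma isClosed_root (hT : T r = r) : IsClosed (univ.erase r) T := by
  intro x hx
  obtain rfl : x = r := by simpa using hx
  simpa using hT

lemma isParking_reduce_iff (h₁ : ∀ i, 1 ≤ P i) (hr : P r = 1) (h₂ : ∀ i, r < i → 2 ≤ P i) :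
    IsParking (fan r (Iio r)) (univ.erase r) (reduce r P) ↔ P ∈ sPF (Kcomplete n) := by
  have key (A : Finset (Fin n)) (hA : r ∉ A) (x : Fin n) (hx : x ∈ A) :
      reduce r P x < inDegree (fan r (Iio r)) x + (univ.erase r \ A).card ↔
        P x < 1 + Aᶜ.card := by
    have hA' : univ.erase r \ A = Aᶜ.erase r := by
      ext y
      simp
    rw [hA', inDegree_fan, ← card_erase_add_one (mem_compl.2 hA), reduce]
    have hx₁ := h₁ x
    rcases lt_trichotomy x r with h | rfl | h
    · rw [if_pos (mem_Iio.2 h), if_neg h.not_gt]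
      omega
    · exact absurd hx hA
    · have hx₂ := h₂ x h
      rw [if_neg (fun h' => (mem_Iio.1 h').not_gt h), if_pos h]
      omega
  rw [mem_sPF_Kcomplete]
  constructor
  · refine fun h => ⟨h₁, fun A hne hA => ?_⟩
    by_cases hrA : r ∈ A
    · refine ⟨r, hrA, ?_⟩
      have : 0 < Aᶜ.card := card_pos.2 (nonempty_iff_ne_empty.2 (by simpa using hA))
      omega
    · obtain ⟨x, hx, hlt⟩ := h A (subset_erase.2 ⟨subset_univ _, hrA⟩) hne
      exact ⟨x, hx, (key A hrA x hx).1 hlt⟩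
  · intro h A hA hne
    have hrA : r ∉ A := (subset_erase.1 hA).2
    obtain ⟨x, hx, hlt⟩ := h.2 A hne (fun h => hrA (h ▸ mem_univ r))
    exact ⟨x, hx, (key A hrA x hx).2 hlt⟩

lemma isForest_root_iff (hT : T r = r) :
    IsForest (fan r (Iio r)) (univ.erase r) T ↔ (T, r) ∈ Un n := by
  constructor
  · intro h
    refine ⟨⟨hT, fun x => ?_⟩, fun x hx hxr => ?_⟩
    · by_cases hx : x = r
      · exact ⟨0, hx⟩
      · obtain ⟨k, hk⟩ := h.escape x (by simpa using hx)
        exact ⟨k, by simpa using hk⟩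
    · replace hx : T x = r := hx
      simpa [hx] using h.mem x (by simpa using hxr)
  · rintro ⟨⟨-, h⟩, hlt⟩
    refine ⟨fun x hx => ?_, fun x _ => ?_⟩
    · have hxr := ne_of_mem_erase hx
      by_cases hTx : T x = r
      · exact .inr (mem_fan.2 ⟨hTx, mem_Iio.2 (hlt x hTx hxr)⟩)
      · exact .inl (by simpa using hTx)
    · obtain ⟨k, hk⟩ := h x
      exact ⟨k, by simpa using hk⟩

lemma eq_root_of_iterate_eq (h : IsRootedTree T r) {x : Fin n} {m : ℕ} (hx : T^[m + 1] x = x) :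
    x = r := by
  obtain ⟨k, hk⟩ := h.2 x
  have h₁ : T^[(m + 1) * k] x = x := Function.IsPeriodicPt.mul_const hx k
  rw [add_mul, one_mul, Function.iterate_add_apply, hk, Function.iterate_fixed h.1] at h₁
  exact h₁.symm

lemma isAbove_unique (h : IsRootedTree T r) {c c' x : Fin n} (hc : c ≠ r) (hc' : c' ≠ r)
    (hT : T c = T c') (hcx : IsAbove T c x) (hcx' : IsAbove T c' x) : c = c' := by
  have key {a b : Fin n} (hb : b ≠ r) (hab : T a = T b) (d : ℕ) (hd : T^[d] a = b) : a = b := by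
    cases d with
    | zero => exact hd
    | succ d =>
      rw [Function.iterate_succ_apply, hab, ← Function.iterate_succ_apply] at hd
      exact absurd (eq_root_of_iterate_eq h hd) hb
  obtain ⟨k, rfl⟩ := hcx
  obtain ⟨k', rfl⟩ := hcx'
  rcases le_total k k' with hk | hk
  · refine key hc' hT (k' - k) ?_
    rw [← Function.iterate_add_apply, Nat.sub_add_cancel hk]
  · refine (key hc hT.symm (k - k') ?_).symm
    rw [← Function.iterate_add_apply, Nat.sub_add_cancel hk]

lemma kappa_eq_card_skipped (h : (T, r) ∈ Un n) :
    kappa T r = (skipped r T (fan r (Iio r)) (univ.erase r)).card := by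
  obtain ⟨hroot, hlt⟩ := h
  rw [← Set.ncard_coe_finset, kappa]
  refine Set.ncard_congr (fun p _ => (T p.1, p.2)) ?_ ?_ ?_
  · rintro ⟨c, x⟩ ⟨⟨-, hcx⟩, hxc, hcr, -⟩
    have hxr : x ≠ r := by
      rintro rfl
      obtain ⟨k, hk⟩ := hcx
      rw [Function.iterate_fixed hroot.1] at hk
      exact hcr hk.symm
    simp only [skipped, coe_filter, mem_univ, true_and, Set.mem_ofPred_eq, mem_erase, and_true]
    refine ⟨⟨c, rfl, hcr, hcx, hxc⟩, hxr, ?_⟩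
    by_cases hTc : T c = r
    · exact .inr (mem_fan.2 ⟨hTc, mem_Iio.2 (hxc.trans (hlt c hTc hcr))⟩)
    · exact .inl hTc
  · rintro ⟨c, x⟩ ⟨c', x'⟩ ⟨⟨-, hcx⟩, -, hcr, -⟩ ⟨⟨-, hcx'⟩, -, hcr', -⟩ heq
    obtain ⟨hT, rfl⟩ := Prod.ext_iff.1 heq
    exact Prod.ext (isAbove_unique hroot hcr hcr' hT hcx hcx') rfl
  · rintro ⟨y, x⟩ he
    simp only [skipped, coe_filter, mem_univ, true_and, Set.mem_ofPred_eq] at he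
    obtain ⟨⟨c, hTc, hcr, hcx, hxc⟩, -⟩ := he
    refine ⟨(c, x), ⟨⟨hxc.ne', hcx⟩, hxc, hcr, fun (hTx : T c = x) => ?_⟩, Prod.ext hTc rfl⟩
    obtain ⟨k, hk⟩ := hcx
    refine hcr (eq_root_of_iterate_eq (T := T) hroot (m := k) ?_)
    rwa [Function.iterate_succ_apply, hTx]

namespace IsBurning

lemma mem_sPF (h : IsBurning P T r) : P ∈ sPF (Kcomplete n) :=
  (isParking_reduce_iff h.one_le h.eq_one h.two_le).1 (h.burn.isParking (isState_root r))

lemma mem_Un (h : IsBurning P T r) : (T, r) ∈ Un n :=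
  (isForest_root_iff h.root).1 (h.burn.isForest (isState_root r))

lemma root_unique {T' : Fin n → Fin n} {r' : Fin n} (h : IsBurning P T r)
    (h' : IsBurning P T' r') : r = r' := by
  have h₁ := h.eq_one
  have h₁' := h'.eq_one
  rcases lt_trichotomy r r' with hlt | heq | hlt
  · have := h.two_le _ hlt
    omega
  · exact heq
  · have := h'.two_le _ hlt
    omega

lemma tree_unique {T' : Fin n → Fin n} (h : IsBurning P T r) (h' : IsBurning P T' r) :
    T = T' := by
  ext1 x
  by_cases hx : x = r
  · rw [hx, h.root, h'.root]
  · exact h.burn.forest_unique h'.burn x (by simpa using hx)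

lemma parking_unique {P' : Fin n → ℕ} (h : IsBurning P T r) (h' : IsBurning P' T r) :
    P = P' := by
  ext1 x
  by_cases hx : x = r
  · rw [hx, h.eq_one, h'.eq_one]
  · have hred := h.burn.parking_unique h'.burn x (by simpa using hx)
    have h₁ := h.one_le x
    have h₁' := h'.one_le x
    unfold reduce at hred
    split_ifs at hred with hlt
    · have h₂ := h.two_le x hlt
      have h₂' := h'.two_le x hlt
      omega
    · omega

lemma sum_add_kappa (h : IsBurning P T r) : ∑ i, P i + kappa T r = n.choose 2 + 1 := by
  have hB := h.burn.sum_add_card_skipped (r := r) (isState_root r) (isClosed_root h.root)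
    (notMem_erase r univ) ((isClosed_root h.root).isOrdered_fan (notMem_erase r univ)
      (notMem_erase r univ) (fun c _ hc => by simpa using hc) fun x hx => by
        simpa using (mem_Iio.1 hx).ne)
  rw [← kappa_eq_card_skipped h.mem_Un, length_fan, Fin.card_Iio, card_erase_of_mem (mem_univ r),
    card_univ, Fintype.card_fin] at hB
  have hsum : ∀ i ∈ univ.erase r, P i = reduce r P i + 1 + if r < i then 1 else 0 := by
    intro i _
    have h₁ := h.one_le i
    rw [reduce]
    split_ifs with hlt
    · have h₂ := h.two_le i hlt
      omega
    · omega
  have hIoi : (univ.erase r).filter (fun i => r < i) = Ioi r := by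
    ext i
    simpa using fun h : r < i => h.ne'
  rw [← add_sum_erase _ _ (mem_univ r), h.eq_one, sum_congr rfl hsum, sum_add_distrib,
    sum_add_distrib, sum_const, smul_eq_mul, mul_one, sum_boole, hIoi, Fin.card_Ioi,
    card_erase_of_mem (mem_univ r), card_univ, Fintype.card_fin]
  obtain ⟨m, rfl⟩ : ∃ m, n = m + 1 := ⟨n - 1, by have := r.isLt; omega⟩
  have hr := r.isLt
  rw [Nat.choose_succ_succ', Nat.choose_one_right, one_add_one_eq_two]
  simp only [Nat.cast_id, Nat.add_sub_cancel] at hB ⊢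
  omega

end IsBurning

lemma exists_isBurning_of_mem_sPF (hn : 2 ≤ n) (hP : P ∈ sPF (Kcomplete n)) :
    ∃ T r, IsBurning P T r := by
  obtain ⟨h₁, hA⟩ := mem_sPF_Kcomplete.1 hP
  have hne : (univ.filter fun i => P i = 1).Nonempty := by
    let i₀ : Fin n := ⟨0, by omega⟩
    have hcard : ({i₀}ᶜ : Finset (Fin n)).card = n - 1 := by simp [card_compl]
    obtain ⟨i, -, hi⟩ := hA {i₀}ᶜ (card_pos.1 (by omega)) (by simp)
    rw [compl_compl, card_singleton] at hi
    have := h₁ i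
    exact ⟨i, by simp; omega⟩
  obtain ⟨r, hr, hmax⟩ := exists_max_image _ id hne
  have hr₁ : P r = 1 := (mem_filter.1 hr).2
  have h₂ : ∀ i, r < i → 2 ≤ P i := by
    intro i hi
    have := h₁ i
    by_contra hlt
    exact hi.not_ge (hmax i (by simp; omega))
  obtain ⟨T, hT, hB⟩ := exists_burn_of_isParking (isState_root r)
    ((isParking_reduce_iff h₁ hr₁ h₂).2 hP) id
  exact ⟨T, r, hT r (notMem_erase r univ), h₁, hr₁, h₂, hB⟩

lemma exists_isBurning_of_mem_Un (h : (T, r) ∈ Un n) : ∃ P, IsBurning P T r := by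
  obtain ⟨p, hp, hB⟩ := exists_burn_of_isForest (isState_root r) ((isForest_root_iff h.1.1).2 h) 0
  have hpr : p r = 0 := hp r (notMem_erase r univ)
  refine ⟨fun i => p i + 1 + if r < i then 1 else 0, h.1.1, fun i => by omega, by simp [hpr],
    fun i hi => by simp [hi], ?_⟩
  convert hB using 1
  ext i
  simp only [reduce]
  omega

end Complete

end DepthFirst

/-- There is a bijection `φ_n : sPF(K_{n+1}) → U_n` with
`sum(P) = C(n,2) − κ(K_n, φ_n(P)) + 1`. -/
theorem stmt8 (n : ℕ) (hn : 2 ≤ n) :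
    ∃ φ : (Fin n → ℕ) → ((Fin n → Fin n) × Fin n),
      Set.BijOn φ (sPF (Kcomplete n)) (Un n) ∧
      ∀ P ∈ sPF (Kcomplete n),
        ((∑ i, P i : ℕ) : ℤ) = (n.choose 2 : ℤ) - (kappa (φ P).1 (φ P).2 : ℤ) + 1 := by
  have : NeZero n := ⟨by omega⟩
  have hex : ∀ P : Fin n → ℕ, ∃ q : (Fin n → Fin n) × Fin n,
      P ∈ sPF (Kcomplete n) → DepthFirst.IsBurning P q.1 q.2 := by
    intro P
    by_cases hP : P ∈ sPF (Kcomplete n)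
    · obtain ⟨T, r, h⟩ := DepthFirst.exists_isBurning_of_mem_sPF hn hP
      exact ⟨(T, r), fun _ => h⟩
    · exact ⟨(id, 0), fun h => absurd h hP⟩
  choose φ hφ using hex
  refine ⟨φ, ⟨fun P hP => (hφ P hP).mem_Un, ?_, ?_⟩, fun P hP => ?_⟩
  · intro P hP P' hP' heq
    exact (hφ P hP).parking_unique (heq ▸ hφ P' hP')
  · rintro ⟨T, r⟩ hT
    obtain ⟨P, hP⟩ := DepthFirst.exists_isBurning_of_mem_Un hT
    have h := hφ P hP.mem_sPF
    have hr := h.root_unique hP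
    exact ⟨P, hP.mem_sPF, Prod.ext (h.tree_unique (hr ▸ hP)) hr⟩
  · have := (hφ P hP).sum_add_kappa
    omega
end

section
/- Let n ≥ 3 and let G = K_{n+1} − {e_1} be the graph obtained from the complete graph K_{n+1} on {0,1,…,n} by deleting the edge e_1 joining 1 and n. Then there is a bijection from sPF(G) onto U_n', the set of uprooted trees on [n] in which 1 and n are not adjacent; in particular |sPF(K_{n+1} − {e_1})| = |U_n'|. -/
/-- Adjacency matrix of `K_{n+1} − {e_1}`, the complete graph on `{0,…,n}` with the edge
between the vertices `1` and `n` deleted. -/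
def KminusE1 (n : ℕ) : Fin (n + 1) → Fin (n + 1) → ℕ := fun i j =>
  if i = j then 0
  else if (i = 1 ∧ j = Fin.last n) ∨ (i = Fin.last n ∧ j = 1) then 0
  else 1

/-- The set `U_n'` of uprooted trees on `[n]` in which the vertices `v1` and `vn`
(standing for `1` and `n`) are not adjacent. -/
def Unp (n : ℕ) (v1 vn : Fin n) : Set ((Fin n → Fin n) × Fin n) :=
  {p | IsUprooted p.1 p.2 ∧ ¬(p.1 v1 = vn ∨ p.1 vn = v1)}

/-- `ℓ` is the distance to the root `r` along the parent function `par`. -/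
def IsLevel {V : Type*} (par : V → V) (r : V) (ℓ : V → ℕ) : Prop :=
  ℓ r = 0 ∧ ∀ i, i ≠ r → ℓ i = ℓ (par i) + 1

theorem IsLevel.eq_zero_iff {V : Type*} {par : V → V} {r : V} {ℓ : V → ℕ} (h : IsLevel par r ℓ) {i : V} :
    ℓ i = 0 ↔ i = r := by
  refine ⟨fun hi => ?_, fun hi => hi ▸ h.1⟩
  by_contra hne
  have := h.2 i hne
  omega

theorem IsLevel.unique {V : Type*} {par : V → V} {r : V} {ℓ ℓ' : V → ℕ} (h : IsLevel par r ℓ)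
    (h' : IsLevel par r ℓ') : ℓ = ℓ' := by
  funext i
  induction hk : ℓ i generalizing i with
  | zero => rw [h.eq_zero_iff.1 hk, h'.1]
  | succ k ih =>
    have hne : i ≠ r := fun e => by rw [e, h.1] at hk; omega
    rw [h'.2 i hne, ← ih (par i) (by have := h.2 i hne; omega)]

theorem IsLevel.iterate_eq {V : Type*} {par : V → V} {r : V} {ℓ : V → ℕ} (h : IsLevel par r ℓ) (i : V) :
    par^[ℓ i] i = r := by
  induction hk : ℓ i generalizing i with
  | zero => exact h.eq_zero_iff.1 hk
  | succ k ih =>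
    have hne : i ≠ r := fun e => by rw [e, h.1] at hk; omega
    exact ih (par i) (by have := h.2 i hne; omega)

theorem IsLevel.exists_child {V : Type*} {par : V → V} {r : V} {ℓ : V → ℕ} (h : IsLevel par r ℓ) {i : V}
    (hi : i ≠ r) : ∃ c, c ≠ r ∧ par c = r := by
  induction hk : ℓ i generalizing i with
  | zero => exact absurd (h.eq_zero_iff.1 hk) hi
  | succ k ih =>
    by_cases hp : par i = r
    · exact ⟨i, hi, hp⟩
    · exact ih hp (by have := h.2 i hi; omega)

section ParentRank

variable {V : Type*} [Fintype V] [LinearOrder V] (Adj : V → V → Prop) [DecidableRel Adj]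

/-- The number of neighbours of `i` that precede `p` when vertices are ordered by level `ℓ` first
and by label second. -/
def parentRank (ℓ : V → ℕ) (i p : V) : ℕ :=
  (Finset.univ.filter fun j => Adj i j ∧ toLex (ℓ j, j) < toLex (ℓ p, p)).card

variable {Adj}

theorem parentRank_lt_of_forall {ℓ : V → ℕ} {i p : V} (hp : Adj i p) {s : Finset V}
    (hs : ∀ j, Adj i j → ℓ j ≤ ℓ p → j ∈ s) :
    parentRank Adj ℓ i p < (s.filter fun j => Adj i j).card := by
  apply Finset.card_lt_card
  rw [Finset.ssubset_iff_of_subset]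
  · exact ⟨p, by simp [hp, hs p hp le_rfl], by simp⟩
  · intro j hj
    simp only [Finset.mem_filter, Finset.mem_univ, true_and, Prod.Lex.toLex_lt_toLex] at hj ⊢
    exact ⟨hs j hj.1 (by rcases hj.2 with h | h <;> omega), hj.1⟩

theorem parentRank_lt {ℓ : V → ℕ} {i p : V} {k : ℕ} (hp : Adj i p) (hk : ℓ p ≤ k) :
    parentRank Adj ℓ i p < ((Finset.univ.filter fun j => ℓ j ≤ k).filter fun j => Adj i j).card :=
  parentRank_lt_of_forall hp fun j _ hj => by simpa using hj.trans hk

theorem le_parentRank {ℓ : V → ℕ} {i p : V} {k : ℕ} (hk : k < ℓ p) :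
    ((Finset.univ.filter fun j => ℓ j ≤ k).filter fun j => Adj i j).card ≤
      parentRank Adj ℓ i p := by
  apply Finset.card_le_card
  intro j hj
  simp only [Finset.mem_filter, Finset.mem_univ, true_and, Prod.Lex.toLex_lt_toLex] at hj ⊢
  exact ⟨hj.2, Or.inl (by omega)⟩

theorem parentRank_lt_parentRank {ℓ : V → ℕ} {i p q : V} (hp : Adj i p)
    (h : toLex (ℓ p, p) < toLex (ℓ q, q)) : parentRank Adj ℓ i p < parentRank Adj ℓ i q := by
  apply Finset.card_lt_card
  rw [Finset.ssubset_iff_of_subset]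
  · exact ⟨p, by simp [hp, h], by simp⟩
  · intro j hj
    simp only [Finset.mem_filter, Finset.mem_univ, true_and] at hj ⊢
    exact ⟨hj.1, hj.2.trans h⟩

theorem parentRank_injective {ℓ : V → ℕ} {i p q : V} (hp : Adj i p) (hq : Adj i q)
    (h : parentRank Adj ℓ i p = parentRank Adj ℓ i q) : p = q := by
  rcases lt_trichotomy (toLex (ℓ p, p)) (toLex (ℓ q, q)) with h' | h' | h'
  · exact absurd h (parentRank_lt_parentRank hp h').ne
  · exact congrArg (fun x => (ofLex x).2) h'
  · exact absurd h (parentRank_lt_parentRank hq h').ne'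

theorem exists_parentRank_eq (ℓ : V → ℕ) {i : V} {m : ℕ}
    (hm : m < (Finset.univ.filter fun j => Adj i j).card) :
    ∃ p, Adj i p ∧ parentRank Adj ℓ i p = m := by
  have h := Finset.surjOn_of_injOn_of_card_le (s := Finset.univ.filter fun j => Adj i j)
    (t := Finset.range (Finset.univ.filter fun j => Adj i j).card) (parentRank Adj ℓ i)
    (fun p hp => by
      simpa using parentRank_lt_of_forall (ℓ := ℓ) (s := Finset.univ)
        (by simpa using hp : Adj i p) (by simp))
    (fun p hp q hq h => parentRank_injective (by simpa using hp) (by simpa using hq) h)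
    (by simp)
  obtain ⟨p, hp, hpm⟩ := h (by simpa using hm : m ∈ _)
  exact ⟨p, by simpa using hp, hpm⟩

theorem IsLevel.parentRank_root {par : V → V} {r : V} {ℓ : V → ℕ} (h : IsLevel par r ℓ) (i : V) :
    parentRank Adj ℓ i r = 0 := by
  simp only [parentRank, Finset.card_eq_zero, Finset.filter_eq_empty_iff, not_and,
    Prod.Lex.toLex_lt_toLex, h.1, Finset.mem_univ, forall_const]
  rintro j - (hj | ⟨hj, hlt⟩)
  · omega
  · exact hlt.ne (h.eq_zero_iff.1 hj)

/-- The rank code of a tree determines the levels of its vertices. -/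
theorem IsLevel.eq_of_parentRank_eq {par par' : V → V} {r : V} {ℓ ℓ' : V → ℕ}
    (h : IsLevel par r ℓ) (h' : IsLevel par' r ℓ') (hadj : ∀ i, i ≠ r → Adj i (par i))
    (hadj' : ∀ i, i ≠ r → Adj i (par' i))
    (heq : ∀ i, i ≠ r → parentRank Adj ℓ i (par i) = parentRank Adj ℓ' i (par' i)) :
    ℓ = ℓ' := by
  have key : ∀ k i, ℓ i ≤ k ↔ ℓ' i ≤ k := by
    intro k
    induction k with
    | zero => intro i; rw [Nat.le_zero, Nat.le_zero, h.eq_zero_iff, h'.eq_zero_iff]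
    | succ k ih =>
      intro i
      by_cases hi : i = r
      · simp [hi, h.1, h'.1]
      have hs : (Finset.univ.filter fun j => ℓ j ≤ k) = Finset.univ.filter fun j => ℓ' j ≤ k := by
        ext j; simp [ih j]
      have aux : ∀ {p : V → V} {d : V → ℕ}, IsLevel p r d → Adj i (p i) → (d i ≤ k + 1 ↔
          parentRank Adj d i (p i) <
            ((Finset.univ.filter fun j => d j ≤ k).filter fun j => Adj i j).card) := by
        intro p d hd ha
        rw [hd.2 i hi]
        refine ⟨fun hle => parentRank_lt ha (by omega), fun hlt => ?_⟩
        by_contra hle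
        exact absurd hlt (le_parentRank (by omega)).not_gt
      rw [aux h (hadj i hi), aux h' (hadj' i hi), hs, heq i hi]
  funext i
  exact le_antisymm ((key _ i).2 le_rfl) ((key _ i).1 le_rfl)

/-- The set of vertices burnt after `k` rounds of Dhar's algorithm started at `r`. -/
def burnt (Adj : V → V → Prop) [DecidableRel Adj] (Q : V → ℕ) (r : V) : ℕ → Finset V
  | 0 => {r}
  | k + 1 => burnt Adj Q r k ∪
      Finset.univ.filter fun i => Q i < ((burnt Adj Q r k).filter fun j => Adj i j).card

theorem burnt_mono (Q : V → ℕ) (r : V) : Monotone (burnt Adj Q r) :=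
  monotone_nat_of_le_succ fun _ => Finset.subset_union_left

theorem root_mem_burnt (Q : V → ℕ) (r : V) (k : ℕ) : r ∈ burnt Adj Q r k :=
  burnt_mono Q r k.zero_le (Finset.mem_singleton_self r)

theorem exists_mem_burnt {Q : V → ℕ} {r : V}
    (hQ : ∀ A : Finset V, A.Nonempty → r ∉ A → ∃ i ∈ A, Q i < (Aᶜ.filter fun j => Adj i j).card)
    (i : V) : ∃ k, i ∈ burnt Adj Q r k := by
  have grow : ∀ k, burnt Adj Q r k = Finset.univ ∨ k < (burnt Adj Q r k).card := by
    intro k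
    induction k with
    | zero => right; simp [burnt]
    | succ k ih =>
      by_cases hu : burnt Adj Q r k = Finset.univ
      · exact Or.inl (Finset.eq_univ_iff_forall.2 fun j =>
          burnt_mono Q r k.le_succ (hu ▸ Finset.mem_univ j))
      · right
        obtain ⟨j, hj, hlt⟩ := hQ (burnt Adj Q r k)ᶜ
          (by rwa [Finset.nonempty_iff_ne_empty, Ne, Finset.compl_eq_empty_iff])
          (by simpa using root_mem_burnt Q r k)
        rw [compl_compl] at hlt
        refine Nat.lt_of_le_of_lt (ih.resolve_left hu) (Finset.card_lt_card ?_)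
        rw [Finset.ssubset_iff_of_subset (burnt_mono Q r k.le_succ)]
        exact ⟨j, by simp [burnt, hlt], by simpa using hj⟩
  refine ⟨Fintype.card V, ?_⟩
  rcases grow (Fintype.card V) with h | h
  · rw [h]; exact Finset.mem_univ i
  · exact absurd h (Finset.card_le_univ _).not_gt

/-- Every parking function with respect to `r` is the rank code of a spanning tree rooted at
`r`. -/
theorem exists_isLevel_parentRank_eq {Q : V → ℕ} {r : V}
    (hQ : ∀ A : Finset V, A.Nonempty → r ∉ A → ∃ i ∈ A, Q i < (Aᶜ.filter fun j => Adj i j).card) :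
    ∃ par ℓ, par r = r ∧ IsLevel par r ℓ ∧
      ∀ i, i ≠ r → Adj i (par i) ∧ parentRank Adj ℓ i (par i) = Q i := by
  have hex := exists_mem_burnt hQ
  obtain ⟨ℓ, hℓ⟩ : ∃ ℓ : V → ℕ, ∀ i k, ℓ i ≤ k ↔ i ∈ burnt Adj Q r k :=
    ⟨fun i => Nat.find (hex i), fun i k =>
      ⟨fun h => burnt_mono Q r h (Nat.find_spec (hex i)), fun h => Nat.find_min' _ h⟩⟩
  have hs : ∀ k, (Finset.univ.filter fun j => ℓ j ≤ k) = burnt Adj Q r k := by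
    intro k; ext j; simp [hℓ]
  have hr : ∀ i, ℓ i = 0 ↔ i = r := by
    intro i; rw [← Nat.le_zero, hℓ]; simp [burnt]
  have hlt : ∀ i, i ≠ r → ∀ k, ℓ i ≤ k + 1 ↔
      Q i < ((Finset.univ.filter fun j => ℓ j ≤ k).filter fun j => Adj i j).card := by
    intro i hi k
    induction k with
    | zero => rw [hℓ, hs, burnt.eq_2, Finset.mem_union, Finset.mem_filter]; simp [burnt, hi]
    | succ k ih =>
      rw [hℓ, hs, burnt, Finset.mem_union, ← hℓ, ih, hs]
      simp only [Finset.mem_filter, Finset.mem_univ, true_and, or_iff_right_iff_imp]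
      exact fun h => h.trans_le
        (Finset.card_le_card (Finset.filter_subset_filter _ (burnt_mono Q r k.le_succ)))
  have hpar : ∀ i, ∃ p, (i = r → p = r) ∧ (i ≠ r → Adj i p ∧ parentRank Adj ℓ i p = Q i) := by
    intro i
    by_cases hi : i = r
    · exact ⟨r, fun _ => rfl, fun h => absurd hi h⟩
    · obtain ⟨p, hp⟩ := exists_parentRank_eq (Adj := Adj) ℓ (i := i) (m := Q i)
        (((hlt i hi (ℓ i)).1 (by omega)).trans_le
          (Finset.card_le_card (Finset.filter_subset_filter _ (Finset.subset_univ _))))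
      exact ⟨p, fun h => absurd h hi, fun _ => hp⟩
  choose par hpar_root hpar_rank using hpar
  refine ⟨par, ℓ, hpar_root r rfl, ⟨(hr r).2 rfl, fun i hi => ?_⟩, hpar_rank⟩
  obtain ⟨ha, hq⟩ := hpar_rank i hi
  apply le_antisymm
  · rw [hlt i hi, ← hq]
    exact parentRank_lt ha le_rfl
  · by_contra hle
    obtain ⟨k, hk⟩ : ∃ k, ℓ i = k + 1 :=
      Nat.exists_eq_succ_of_ne_zero fun h => hi ((hr i).1 h)
    have h1 := (hlt i hi k).1 hk.le
    have h2 := le_parentRank (Adj := Adj) (i := i) (show k < ℓ (par i) by omega)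
    omega

end ParentRank

theorem IsLevel.isRootedTree {n : ℕ} {par : Fin n → Fin n} {r : Fin n} {ℓ : Fin n → ℕ}
    (h : IsLevel par r ℓ) (hr : par r = r) : IsRootedTree par r :=
  ⟨hr, fun i => ⟨ℓ i, h.iterate_eq i⟩⟩

/-- The distance from `i` to the root `r` along the parent function `par`. -/
noncomputable def depth {n : ℕ} (par : Fin n → Fin n) (r i : Fin n) : ℕ :=
  sInf {k | par^[k] i = r}

theorem IsRootedTree.isLevel_depth {n : ℕ} {par : Fin n → Fin n} {r : Fin n}
    (h : IsRootedTree par r) : IsLevel par r (depth par r) := by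
  have hd : ∀ i, depth par r i = Nat.find (h.2 i) := fun i =>
    (Nat.sInf_def (h.2 i)).trans (by congr)
  refine ⟨by rw [hd]; exact (Nat.find_eq_zero _).2 rfl, fun i hi => ?_⟩
  rw [hd, hd]
  exact Nat.find_comp_succ (h.2 i) (h.2 (par i)) hi

/-- Adjacency in the complete graph with the edge between `v` and `w` deleted. -/
def AdjExcept {V : Type*} (v w i j : V) : Prop :=
  i ≠ j ∧ ¬((i = v ∧ j = w) ∨ (i = w ∧ j = v))

instance {V : Type*} [DecidableEq V] (v w : V) : DecidableRel (AdjExcept v w) :=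
  fun _ _ => inferInstanceAs (Decidable (_ ∧ _))

/-- The spherical parking function of a rooted tree. -/
noncomputable def treeCode {n : ℕ} (v w : Fin n) (p : (Fin n → Fin n) × Fin n) (i : Fin n) : ℕ :=
  if i = p.2 then 1 else 1 + parentRank (AdjExcept v w) (depth p.1 p.2) i (p.1 i)

theorem dA_KminusE1 {n : ℕ} (hn : 0 < n) {A : Finset (Fin n)} {i : Fin n} :
    dA (KminusE1 n) A i = 1 +
      (Aᶜ.filter fun j => AdjExcept ⟨0, by omega⟩ ⟨n - 1, by omega⟩ i j).card := by
  obtain ⟨m, rfl⟩ : ∃ m, n = m + 1 := ⟨n - 1, by omega⟩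
  have hlast : (0 : Fin (m + 2)) ≠ Fin.last (m + 1) := by simp [Fin.ext_iff]
  have h01 : (0 : Fin (m + 2)) ≠ 1 := by simp
  rw [dA, Finset.card_filter]
  congr 1
  · simp [KminusE1, hlast, h01, Fin.succ_ne_zero]
  · refine Finset.sum_congr rfl fun j _ => ?_
    simp only [KminusE1, AdjExcept, Fin.ext_iff, Fin.val_succ, Fin.val_one, Fin.val_last]
    split_ifs <;> omega

theorem mem_sPF_KminusE1 {n : ℕ} (hn : 0 < n) {P : Fin n → ℕ} :
    P ∈ sPF (KminusE1 n) ↔ (∀ i, 1 ≤ P i) ∧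
      ∀ A : Finset (Fin n), A.Nonempty → A ≠ Finset.univ → ∃ i ∈ A, P i <
        1 + (Aᶜ.filter fun j => AdjExcept ⟨0, by omega⟩ ⟨n - 1, by omega⟩ i j).card := by
  simp [sPF, dA_KminusE1 hn]

section Unp

variable {n : ℕ} {v w : Fin n} {p : (Fin n → Fin n) × Fin n}

theorem adjExcept_par (hp : p ∈ Unp n v w) {i : Fin n} (hi : i ≠ p.2) :
    AdjExcept v w i (p.1 i) := by
  refine ⟨fun h => ?_, ?_⟩
  · have := hp.1.1.isLevel_depth.2 i hi
    rw [← h] at this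
    omega
  · rintro (⟨rfl, h⟩ | ⟨rfl, h⟩)
    · exact hp.2 (Or.inl h)
    · exact hp.2 (Or.inr h)

theorem root_ne_of_mem_Unp (hv : ∀ i, v ≤ i) (hvw : v ≠ w) (hp : p ∈ Unp n v w) : p.2 ≠ v := by
  intro h
  obtain ⟨c, hc, hpc⟩ := hp.1.1.isLevel_depth.exists_child (i := w) (h ▸ hvw.symm)
  exact (hp.1.2 c hpc hc).not_ge (h ▸ hv c)

/-- The root is the largest vertex at which the tree code attains its minimum. -/
theorem le_root_of_treeCode_eq_one (hv : ∀ i, v ≤ i) (hw : ∀ i, i ≤ w) (hvw : v ≠ w)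
    (hp : p ∈ Unp n v w) {i : Fin n} (hi : treeCode v w p i = 1) : i ≤ p.2 := by
  by_contra! hlt
  have hne : i ≠ p.2 := hlt.ne'
  have hlev := hp.1.1.isLevel_depth
  have hadj : AdjExcept v w i p.2 := by
    refine ⟨hne, ?_⟩
    rintro (⟨-, h⟩ | ⟨-, h⟩)
    · exact hlt.not_ge (h ▸ hw i)
    · exact root_ne_of_mem_Unp hv hvw hp h
  have hpar : p.2 = p.1 i := parentRank_injective hadj (adjExcept_par hp hne) <| by
    rw [hlev.parentRank_root]
    simp only [treeCode, hne, if_false] at hi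
    omega
  exact hlt.not_gt (hp.1.2 i hpar.symm hne)

theorem injOn_treeCode (hv : ∀ i, v ≤ i) (hw : ∀ i, i ≤ w) (hvw : v ≠ w) :
    Set.InjOn (treeCode v w) (Unp n v w) := by
  rintro ⟨par, r⟩ hp ⟨par', r'⟩ hp' h
  have hr : r = r' := le_antisymm
    (le_root_of_treeCode_eq_one hv hw hvw hp' (by rw [← h]; simp [treeCode]))
    (le_root_of_treeCode_eq_one hv hw hvw hp (by rw [h]; simp [treeCode]))
  subst hr
  have heq : ∀ i, i ≠ r → parentRank (AdjExcept v w) (depth par r) i (par i) =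
      parentRank (AdjExcept v w) (depth par' r) i (par' i) := by
    intro i hi
    simpa [treeCode, hi] using congrFun h i
  have hd := hp.1.1.isLevel_depth.eq_of_parentRank_eq hp'.1.1.isLevel_depth
    (fun i hi => adjExcept_par hp hi) (fun i hi => adjExcept_par hp' hi) heq
  congr 1
  funext i
  by_cases hi : i = r
  · rw [hi]; exact hp.1.1.1.trans hp'.1.1.1.symm
  · exact parentRank_injective (adjExcept_par hp hi) (adjExcept_par hp' hi)
      (by rw [heq i hi, hd])

theorem exists_mem_treeCode_lt (hv : ∀ i, v ≤ i) (hvw : v ≠ w) (hp : p ∈ Unp n v w)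
    {A : Finset (Fin n)} (hA : A.Nonempty) (hA' : A ≠ Finset.univ) :
    ∃ i ∈ A, treeCode v w p i < 1 + (Aᶜ.filter fun j => AdjExcept v w i j).card := by
  have hlev := hp.1.1.isLevel_depth
  by_cases hr : p.2 ∈ A
  · obtain ⟨j, hj⟩ : ∃ j, j ∉ A := by simpa [Finset.eq_univ_iff_forall] using hA'
    by_cases hadj : AdjExcept v w p.2 j
    · refine ⟨p.2, hr, ?_⟩
      have : 0 < (Aᶜ.filter fun j => AdjExcept v w p.2 j).card :=
        Finset.card_pos.2 ⟨j, by simp [hj, hadj]⟩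
      simpa [treeCode] using this
    have hrv := root_ne_of_mem_Unp hv hvw hp
    obtain ⟨hrw, rfl⟩ : p.2 = w ∧ j = v := by
      have hne : p.2 ≠ j := fun h => hj (h ▸ hr)
      simp only [AdjExcept] at hadj
      tauto
    obtain ⟨c, hc, hpc⟩ := hlev.exists_child hrv.symm
    have hcv : c ≠ j := fun h => hp.2 (Or.inl (by rw [← h, hpc, hrw]))
    have hcode : treeCode j w p c = 1 := by simp [treeCode, hc, hpc, hlev.parentRank_root]
    by_cases hcA : c ∈ A
    · refine ⟨c, hcA, ?_⟩
      have : 0 < (Aᶜ.filter fun k => AdjExcept j w c k).card :=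
        Finset.card_pos.2 ⟨j, by simp [hj, AdjExcept, hcv, hrw ▸ hc]⟩
      omega
    · refine ⟨p.2, hr, ?_⟩
      have : 0 < (Aᶜ.filter fun k => AdjExcept j w p.2 k).card :=
        Finset.card_pos.2 ⟨c, by simp [hcA, AdjExcept, hc.symm, hcv, hrv]⟩
      simpa [treeCode] using this
  · obtain ⟨i, hi, hmin⟩ := A.exists_min_image (depth p.1 p.2) hA
    have hne : i ≠ p.2 := fun h => hr (h ▸ hi)
    refine ⟨i, hi, ?_⟩
    have := parentRank_lt_of_forall (ℓ := depth p.1 p.2) (adjExcept_par hp hne) (s := Aᶜ)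
      fun j _ hj => Finset.mem_compl.2 fun hjA => by
        have h1 := hmin j hjA
        have h2 := hlev.2 i hne
        omega
    simpa [treeCode, hne] using this

theorem exists_treeCode_eq (hvw : v ≠ w) {P : Fin n → ℕ} (hP : ∀ i, 1 ≤ P i)
    (hA : ∀ A : Finset (Fin n), A.Nonempty → A ≠ Finset.univ →
      ∃ i ∈ A, P i < 1 + (Aᶜ.filter fun j => AdjExcept v w i j).card) :
    ∃ p ∈ Unp n v w, treeCode v w p = P := by
  obtain ⟨z, -, hz⟩ := hA {v}ᶜ ⟨w, by simpa using hvw.symm⟩ (by simp)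
  have hz1 : P z = 1 := by
    have := Finset.card_filter_le ({v} : Finset (Fin n)) fun j => AdjExcept v w z j
    simp only [compl_compl] at hz
    have := hP z
    simp only [Finset.card_singleton] at *
    omega
  obtain ⟨r, hr, hmax⟩ := (Finset.univ.filter fun i => P i = 1).exists_max_image id
    ⟨z, by simpa using hz1⟩
  simp only [Finset.mem_filter, Finset.mem_univ, true_and, id] at hr hmax
  obtain ⟨par, ℓ, hroot, hlev, hrank⟩ := exists_isLevel_parentRank_eq (Adj := AdjExcept v w)
    (Q := fun i => P i - 1) (r := r) fun A hne hrA => by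
      obtain ⟨i, hi, hlt⟩ := hA A hne fun h => hrA (h ▸ Finset.mem_univ r)
      have := hP i
      exact ⟨i, hi, by omega⟩
  have htree := hlev.isRootedTree hroot
  have hpar : ∀ i, i ≠ par i → AdjExcept v w i (par i) := fun i hi =>
    (hrank i fun h => hi (by rw [h, hroot])).1
  refine ⟨(par, r), ⟨⟨htree, fun i hi hne => ?_⟩, ?_⟩, ?_⟩
  · have h1 := (hrank i hne).2
    rw [show par i = r from hi, hlev.parentRank_root] at h1
    have := hP i
    exact lt_of_le_of_ne (hmax i (by omega)) hne
  · rintro (h | h)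
    · exact (hpar v (hvw.trans_eq h.symm)).2 (Or.inl ⟨rfl, h⟩)
    · exact (hpar w (hvw.symm.trans_eq h.symm)).2 (Or.inr ⟨rfl, h⟩)
  · funext i
    by_cases hi : i = r
    · simp [treeCode, hi, hr]
    · have := hP i
      simp only [treeCode, hi, if_false, htree.isLevel_depth.unique hlev, (hrank i hi).2]
      omega

end Unp

theorem bijOn_treeCode {n : ℕ} (hn : 2 ≤ n) :
    Set.BijOn (treeCode ⟨0, by omega⟩ ⟨n - 1, by omega⟩)
      (Unp n ⟨0, by omega⟩ ⟨n - 1, by omega⟩) (sPF (KminusE1 n)) := by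
  have hv : ∀ i : Fin n, (⟨0, by omega⟩ : Fin n) ≤ i := fun i => Nat.zero_le _
  have hw : ∀ i : Fin n, i ≤ ⟨n - 1, by omega⟩ := fun i => Nat.le_sub_one_of_lt i.2
  have hvw : (⟨0, by omega⟩ : Fin n) ≠ ⟨n - 1, by omega⟩ := by
    rw [Ne, Fin.mk.injEq]; omega
  refine ⟨fun p hp => ?_, injOn_treeCode hv hw hvw, fun P hP => ?_⟩
  · rw [mem_sPF_KminusE1 (by omega)]
    refine ⟨fun i => ?_, fun A hA hA' => exists_mem_treeCode_lt hv hvw hp hA hA'⟩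
    rw [treeCode]
    split_ifs <;> omega
  · rw [mem_sPF_KminusE1 (by omega)] at hP
    exact exists_treeCode_eq hvw hP.1 hP.2

/-- For `G = K_{n+1} − {e_1}`, there is a bijection from `sPF(G)` onto `U_n'`; in
particular `|sPF(K_{n+1} − {e_1})| = |U_n'|`. -/
theorem stmt10 (n : ℕ) (hn : 3 ≤ n) :
    (∃ φ : (Fin n → ℕ) → ((Fin n → Fin n) × Fin n),
      Set.BijOn φ (sPF (KminusE1 n))
        (Unp n ⟨0, by omega⟩ ⟨n - 1, by omega⟩)) ∧
    (sPF (KminusE1 n)).ncard = (Unp n ⟨0, by omega⟩ ⟨n - 1, by omega⟩).ncard := by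
  have h := bijOn_treeCode (show 2 ≤ n by omega)
  have : Nonempty (Fin n) := ⟨⟨0, by omega⟩⟩
  refine ⟨⟨_, h.invOn_invFunOn.symm.bijOn h.surjOn.mapsTo_invFunOn h.mapsTo⟩, ?_⟩
  rw [← h.image_eq, h.injOn.ncard_image]
end

section
/- For every integer n ≥ 2, the number of uprooted trees on [n] and the number of rooted labelled trees on [n] in which 1 is a non-root leaf are both equal to (n−1)^{n−1}: |U_n| = |B_n| = (n−1)^{n−1}. -/
/-- The set `B_n` of rooted labelled trees on `[n]` in which the vertex `v1`
(standing for `1`) is a non-root leaf, i.e. `v1` is not the root and has no children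
(so its only neighbour is its parent). -/
def Bn (n : ℕ) (v1 : Fin n) : Set ((Fin n → Fin n) × Fin n) :=
  {p | IsRootedTree p.1 p.2 ∧ p.2 ≠ v1 ∧ ∀ i, i ≠ v1 → p.1 i ≠ v1}

open Finset in
open Classical in
/-- Rooted forests with root set `S` and set of non-root vertices `V`, encoded by parent functions
which are the identity outside `V`. -/
noncomputable def rootedForests {α : Type*} [Fintype α] (V S : Finset α) : Finset (α → α) :=
  {f | (∀ i ∉ V, f i = i) ∧ (∀ i ∈ V, f i ∈ V ∪ S) ∧ ∀ i ∈ V, ∃ k, f^[k] i ∈ S}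

section Forests

open Finset

variable {α : Type*} [Fintype α] [DecidableEq α]

theorem mem_rootedForests {V S : Finset α} {f : α → α} :
    f ∈ rootedForests V S ↔
      (∀ i ∉ V, f i = i) ∧ (∀ i ∈ V, f i ∈ V ∪ S) ∧ ∀ i ∈ V, ∃ k, f^[k] i ∈ S := by
  simp only [rootedForests, mem_filter, mem_univ, true_and, mem_union]

theorem piecewise_id_mem_rootedForests {V S : Finset α} (h : Disjoint V S) {f : α → α}
    (hf : f ∈ rootedForests V S) :
    ({i ∈ V | f i ∈ S} : Finset α).piecewise id f ∈
      rootedForests (V \ {i ∈ V | f i ∈ S}) {i ∈ V | f i ∈ S} := by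
  obtain ⟨h1, h2, h3⟩ := mem_rootedForests.1 hf
  set J : Finset α := {i ∈ V | f i ∈ S} with hJ
  have reach : ∀ k, ∀ i ∈ V, f^[k] i ∈ S → ∃ l, (J.piecewise id f)^[l] i ∈ J := by
    intro k
    induction k with
    | zero => exact fun i hi hs => absurd hs (disjoint_left.1 h hi)
    | succ k ih =>
      intro i hi hs
      by_cases hiJ : i ∈ J
      · exact ⟨0, hiJ⟩
      · have hiS : f i ∉ S := fun hc => hiJ (by simp [hJ, hi, hc])
        obtain ⟨l, hl⟩ := ih (f i) ((mem_union.1 (h2 i hi)).resolve_right hiS) hs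
        exact ⟨l + 1, by rwa [Function.iterate_succ_apply, piecewise_eq_of_notMem _ _ _ hiJ]⟩
  refine mem_rootedForests.2 ⟨fun i hi => ?_, fun i hi => ?_, fun i hi => ?_⟩
  · by_cases hiJ : i ∈ J
    · simp [hiJ]
    · rw [piecewise_eq_of_notMem _ _ _ hiJ]
      exact h1 i fun hc => hi (mem_sdiff.2 ⟨hc, hiJ⟩)
  · obtain ⟨hiV, hiJ⟩ := mem_sdiff.1 hi
    have hiS : f i ∉ S := fun hc => hiJ (by simp [hJ, hiV, hc])
    have := (mem_union.1 (h2 i hiV)).resolve_right hiS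
    rw [piecewise_eq_of_notMem _ _ _ hiJ]
    simp only [mem_union, mem_sdiff]
    tauto
  · have hiV := (mem_sdiff.1 hi).1
    obtain ⟨k, hk⟩ := h3 i hiV
    exact reach k i hiV hk

theorem piecewise_mem_rootedForests {V S J : Finset α} (hJ : J ⊆ V) {g f : α → α}
    (hg : ∀ i ∈ J, g i ∈ S) (hf : f ∈ rootedForests (V \ J) J) :
    J.piecewise g f ∈ rootedForests V S := by
  obtain ⟨h1, h2, h3⟩ := mem_rootedForests.1 hf
  have reach : ∀ k, ∀ i, f^[k] i ∈ J → ∃ l, (J.piecewise g f)^[l] i ∈ S := by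
    intro k
    induction k with
    | zero => exact fun i hi => ⟨1, by simpa [show i ∈ J from hi] using hg i hi⟩
    | succ k ih =>
      intro i hi
      by_cases hiJ : i ∈ J
      · exact ⟨1, by simpa [hiJ] using hg i hiJ⟩
      · obtain ⟨l, hl⟩ := ih (f i) hi
        exact ⟨l + 1, by rwa [Function.iterate_succ_apply, piecewise_eq_of_notMem _ _ _ hiJ]⟩
  refine mem_rootedForests.2 ⟨fun i hi => ?_, fun i hi => ?_, fun i hi => ?_⟩
  · rw [piecewise_eq_of_notMem _ _ _ fun hc => hi (hJ hc)]
    exact h1 i fun hc => hi (mem_sdiff.1 hc).1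
  · by_cases hiJ : i ∈ J
    · simp [hiJ, hg i hiJ]
    · have := h2 i (mem_sdiff.2 ⟨hi, hiJ⟩)
      rw [sdiff_union_of_subset hJ] at this
      simp [hiJ, this]
  · by_cases hiJ : i ∈ J
    · exact reach 0 i hiJ
    · obtain ⟨k, hk⟩ := h3 i (mem_sdiff.2 ⟨hi, hiJ⟩)
      exact reach k i hk

/-- The number of forests in which `J` is the set of children of the roots. -/
theorem card_rootedForests_filter {V S J : Finset α} (h : Disjoint V S) (hJ : J ⊆ V) :
    #{f ∈ rootedForests V S | ({i ∈ V | f i ∈ S} : Finset α) = J} =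
      #S ^ #J * #(rootedForests (V \ J) J) := by
  have hcard : #(Fintype.piFinset fun i => if i ∈ J then S else {i}) = #S ^ #J := by
    rw [Fintype.card_piFinset]
    simp [apply_ite]
  rw [← hcard, ← card_product]
  refine card_nbij' (fun f => (J.piecewise f id, J.piecewise id f))
    (fun p => J.piecewise p.1 p.2) ?_ ?_ ?_ ?_
  · intro f hf
    obtain ⟨hfor, rfl⟩ := mem_filter.1 hf
    refine mem_product.2 ⟨Fintype.mem_piFinset.2 fun i => ?_,
      piecewise_id_mem_rootedForests h hfor⟩
    split_ifs with hi
    · simpa only [piecewise_eq_of_mem _ _ _ hi] using (mem_filter.1 hi).2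
    · simp only [piecewise_eq_of_notMem _ _ _ hi, id, mem_singleton]
  · rintro ⟨g, f⟩ hp
    obtain ⟨hg, hf⟩ := mem_product.1 hp
    have hg' : ∀ i ∈ J, g i ∈ S := fun i hi => by
      simpa [hi] using Fintype.mem_piFinset.1 hg i
    refine mem_filter.2 ⟨piecewise_mem_rootedForests hJ hg' hf, ?_⟩
    ext i
    rw [mem_filter]
    by_cases hi : i ∈ J
    · simp [hi, hJ hi, hg' i hi]
    · simp only [hi, iff_false, not_and, piecewise_eq_of_notMem _ _ _ hi]
      intro hiV
      have := (mem_rootedForests.1 hf).2.1 i (mem_sdiff.2 ⟨hiV, hi⟩)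
      rw [sdiff_union_of_subset hJ] at this
      exact disjoint_left.1 h this
  · intro f _
    ext i
    by_cases hi : i ∈ J <;> simp [hi]
  · rintro ⟨g, f⟩ hp
    obtain ⟨hg, hf⟩ := mem_product.1 hp
    refine Prod.ext (funext fun i => ?_) (funext fun i => ?_)
    · by_cases hi : i ∈ J
      · simp [hi]
      · have := Fintype.mem_piFinset.1 hg i
        simp only [hi, if_false, mem_singleton] at this
        simp [hi, this]
    · by_cases hi : i ∈ J
      · have := (mem_rootedForests.1 hf).1 i fun hc => (mem_sdiff.1 hc).2 hi
        simpa [hi] using this.symm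
      · simp [hi]

theorem sum_choose_mul_pow (r m k : ℕ) :
    ∑ j ∈ range (r + 1), r.choose j * (k ^ j * (j * m ^ (r - j))) =
      r * k * (m + k) ^ (r - 1) := by
  cases r with
  | zero => simp
  | succ r =>
    rw [sum_range_succ', add_comm m k, Nat.add_sub_cancel, add_pow, mul_sum]
    simp only [zero_mul, mul_zero, add_zero]
    refine sum_congr rfl fun j _ => ?_
    rw [Nat.add_sub_add_right, show ∀ a b : ℕ, (r + 1).choose (j + 1) * (a * ((j + 1) * b)) =
      ((r + 1).choose (j + 1) * (j + 1)) * a * b by intros; ring, ← Nat.add_one_mul_choose_eq,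
      pow_succ, Nat.cast_id]
    ring

/-- A form of Cayley's formula for forests. -/
theorem card_rootedForests (V S : Finset α) (h : Disjoint V S) :
    (#V + #S) * #(rootedForests V S) = #S * (#V + #S) ^ #V := by
  induction V using Finset.strongInduction generalizing S with
  | H V ih =>
    rcases V.eq_empty_or_nonempty with rfl | hV
    · have : rootedForests ∅ S = {(id : α → α)} := by
        ext f
        simp [mem_rootedForests, funext_iff]
      simp [this]
    · have key : ∀ J ∈ V.powerset,
          #V * #(rootedForests (V \ J) J) = #J * #V ^ (#V - #J) := by
        intro J hJ
        rw [mem_powerset] at hJ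
        rcases J.eq_empty_or_nonempty with rfl | hJne
        · have : rootedForests V (∅ : Finset α) = ∅ := by
            obtain ⟨i, hi⟩ := hV
            refine eq_empty_of_forall_notMem fun f hf => ?_
            obtain ⟨k, hk⟩ := (mem_rootedForests.1 hf).2.2 i hi
            exact notMem_empty _ hk
          simp [this]
        · have := ih (V \ J) (sdiff_ssubset hJ hJne) J sdiff_disjoint
          rwa [card_sdiff_of_subset hJ, Nat.sub_add_cancel (card_le_card hJ)] at this
      have hsum : #V * #(rootedForests V S) = #V * (#S * (#V + #S) ^ (#V - 1)) := by
        rw [card_eq_sum_card_fiberwise (f := fun f : α → α => ({i ∈ V | f i ∈ S} : Finset α))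
          (t := V.powerset) fun f _ => mem_powerset.2 (filter_subset _ _), mul_sum,
          ← mul_assoc, ← sum_choose_mul_pow]
        simp only [← smul_eq_mul (a := Nat.choose _ _)]
        rw [← sum_powerset_apply_card fun j => #S ^ j * (j * #V ^ (#V - j))]
        refine sum_congr rfl fun J hJ => ?_
        rw [card_rootedForests_filter h (mem_powerset.1 hJ), ← key J hJ]
        ring
      rw [Nat.eq_of_mul_eq_mul_left hV.card_pos hsum, mul_left_comm, mul_pow_sub_one hV.card_ne_zero]

end Forests

section Trees

open Finset

theorem isRootedTree_iff {n : ℕ} {par : Fin n → Fin n} {r : Fin n} :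
    IsRootedTree par r ↔ par ∈ rootedForests {r}ᶜ {r} := by
  simp only [mem_rootedForests, IsRootedTree, mem_compl, mem_singleton, not_not, forall_eq,
    mem_union]
  refine and_congr_right fun _ => ⟨fun h => ⟨fun i _ => ne_or_eq _ _, fun i _ => h i⟩, fun h i => ?_⟩
  by_cases hi : i = r
  · exact ⟨0, hi⟩
  · exact h.2 i hi

open Classical in
theorem ncard_eq_sum_card_filter {β γ : Type*} [Fintype β] [Fintype γ] (s : Set (β × γ)) :
    s.ncard = ∑ c, #{b | (b, c) ∈ s} := by
  simp only [Set.ncard_eq_toFinset_card', card_filter]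
  rw [← Fintype.sum_prod_type_right' (f := fun b c => if (b, c) ∈ s then 1 else 0), ← card_filter]
  congr 1
  ext
  simp

open Classical in
theorem card_isUprooted {m : ℕ} (r : Fin (m + 1)) :
    m * #{par | IsUprooted par r} = r * (m + 1) ^ (r - 1 : ℕ) * m ^ (m - r : ℕ) := by
  have hr : (r : ℕ) ≤ m := by omega
  have hmaps : ∀ par ∈ ({par | IsUprooted par r} : Finset _),
      ({i ∈ {r}ᶜ | par i ∈ ({r} : Finset _)} : Finset (Fin (m + 1))) ∈ (Iio r).powerset := by
    intro par hpar
    refine mem_powerset.2 fun i => ?_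
    have := (mem_filter.1 hpar).2.2 i
    simp only [mem_filter, mem_compl, mem_singleton, mem_Iio]
    tauto
  have hfib : ∀ J ∈ (Iio r).powerset,
      #{par ∈ ({par | IsUprooted par r} : Finset _) |
        ({i ∈ {r}ᶜ | par i ∈ ({r} : Finset _)} : Finset (Fin (m + 1))) = J} =
      #(rootedForests ({r}ᶜ \ J) J) := by
    intro J hJ
    have hlt : ∀ i ∈ J, i < r := fun i hi => mem_Iio.1 (mem_powerset.1 hJ hi)
    have := card_rootedForests_filter (V := {r}ᶜ) (S := {r}) (J := J) disjoint_compl_left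
      fun i hi => by simpa using (hlt i hi).ne
    rw [card_singleton, one_pow, one_mul] at this
    rw [← this]
    congr 1
    ext par
    simp only [mem_filter, mem_univ, true_and, IsUprooted, isRootedTree_iff]
    refine and_congr_left fun h => and_iff_left fun i hi hne => hlt i ?_
    rw [← h]
    simp [hi, hne]
  have hcard : ∀ J ∈ (Iio r).powerset, m * #(rootedForests ({r}ᶜ \ J) J) =
      1 ^ #J * (#J * m ^ (r - #J : ℕ)) * m ^ (m - r : ℕ) := by
    intro J hJ
    have hJr := mem_powerset.1 hJ
    have hle : #J ≤ r := by simpa using card_le_card hJr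
    have hsub : J ⊆ {r}ᶜ := fun i hi => by simpa using (mem_Iio.1 (hJr hi)).ne
    have := card_rootedForests ({r}ᶜ \ J) J sdiff_disjoint
    rw [card_sdiff_of_subset hsub, card_compl, Fintype.card_fin, card_singleton, Nat.add_sub_cancel,
      Nat.sub_add_cancel (hle.trans hr)] at this
    rw [this, one_pow, one_mul, mul_assoc, ← pow_add]
    congr 2
    omega
  rw [card_eq_sum_card_fiberwise hmaps, sum_congr rfl hfib, mul_sum, sum_congr rfl hcard, ← sum_mul,
    sum_powerset_apply_card fun j => 1 ^ j * (j * m ^ (r - j : ℕ))]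
  simp only [Fin.card_Iio, smul_eq_mul]
  rw [sum_choose_mul_pow, mul_one]

theorem sum_mul_pow_mul_pow (m N : ℕ) :
    ∑ r ∈ range (N + 1), (r * (m + 1) ^ (r - 1) * m ^ (N - r) : ℤ) =
      m ^ (N + 1) + (N - m) * (m + 1) ^ N := by
  induction N with
  | zero => simp
  | succ N ih =>
    have : ∀ r ∈ range (N + 1), (r * (m + 1) ^ (r - 1) * m ^ (N + 1 - r) : ℤ) =
        r * (m + 1) ^ (r - 1) * m ^ (N - r) * m := by
      intro r hr
      rw [Nat.sub_add_comm (Nat.lt_succ_iff.1 (mem_range.1 hr)), pow_succ, mul_assoc _ _ (m : ℤ)]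
    rw [sum_range_succ, sum_congr rfl this, ← sum_mul, ih]
    simp only [Nat.add_sub_cancel, Nat.sub_self, Nat.cast_add, Nat.cast_one]
    ring

theorem ncard_Un {m : ℕ} (hm : 0 < m) : (Un (m + 1)).ncard = m ^ m := by
  classical
  refine Nat.eq_of_mul_eq_mul_left hm ?_
  rw [ncard_eq_sum_card_filter, mul_sum]
  have := sum_mul_pow_mul_pow m m
  rw [sub_self, zero_mul, add_zero] at this
  rw [← pow_succ', ← Nat.cast_inj (R := ℤ), Nat.cast_pow, ← this, ← Fin.sum_univ_eq_sum_range
    (fun r => (r * (m + 1) ^ (r - 1) * m ^ (m - r) : ℤ)), Nat.cast_sum]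
  refine sum_congr rfl fun r _ => ?_
  exact_mod_cast card_isUprooted r

open Classical in
theorem card_isRootedTree_leaf {m : ℕ} {v r : Fin (m + 1)} (hv : r ≠ v) :
    #{par | (par, r) ∈ Bn (m + 1) v} = m ^ (m - 1) := by
  have hm : 1 ≤ m := by
    by_contra! h
    exact hv (Fin.ext (by omega))
  have hcard := card_rootedForests ({r, v}ᶜ : Finset (Fin (m + 1))) {r}
    (disjoint_singleton_right.2 (by simp))
  rw [card_compl, card_pair hv, Fintype.card_fin, card_singleton,
    show m + 1 - 2 + 1 = m by omega, one_mul, show m + 1 - 2 = m - 1 by omega] at hcard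
  have hc : #({v}ᶜ : Finset (Fin (m + 1))) = m := by simp [card_compl]
  rw [← hcard, ← congrArg (· * _) hc, ← card_product]
  refine card_nbij' (fun f => (f v, Function.update f v v))
    (fun p => Function.update p.2 v p.1) ?_ ?_ ?_ ?_
  · intro f hf
    obtain ⟨⟨hr, hreach⟩, -, hleaf⟩ : IsRootedTree f r ∧ r ≠ v ∧ ∀ i, i ≠ v → f i ≠ v :=
      (mem_filter.1 hf).2
    have hfv : f v ≠ v := by
      intro hc
      obtain ⟨k, hk⟩ := hreach v
      rw [Function.iterate_fixed hc] at hk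
      exact hv hk.symm
    have hiter : ∀ k, ∀ i ≠ v, (Function.update f v v)^[k] i = f^[k] i := by
      intro k
      induction k with
      | zero => simp
      | succ k ih =>
        intro i hi
        rw [Function.iterate_succ_apply, Function.iterate_succ_apply,
          Function.update_of_ne hi, ih _ (hleaf i hi)]
    refine mem_product.2 ⟨by simpa using hfv, mem_rootedForests.2 ⟨fun i hi => ?_, fun i hi => ?_,
      fun i hi => ?_⟩⟩
    · have : i = r ∨ i = v := by simpa [or_iff_not_imp_left] using hi
      rcases this with rfl | rfl
      · simpa [Function.update_of_ne hv] using hr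
      · simp
    · have hi' : i ≠ r ∧ i ≠ v := by simpa using hi
      have := hleaf i hi'.2
      simp only [Function.update_of_ne hi'.2, mem_union, mem_compl, mem_insert, mem_singleton]
      tauto
    · have hi' : i ≠ r ∧ i ≠ v := by simpa using hi
      obtain ⟨k, hk⟩ := hreach i
      exact ⟨k, by simpa [hiter k i hi'.2] using hk⟩
  · rintro ⟨w, f⟩ hp
    obtain ⟨hw, hf⟩ := mem_product.1 hp
    obtain ⟨h1, h2, h3⟩ := mem_rootedForests.1 hf
    have hw : w ≠ v := by simpa using hw
    have hr : f r = r := h1 r (by simp)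
    have hleaf : ∀ i, i ≠ v → f i ≠ v := by
      intro i hi
      by_cases hir : i = r
      · rwa [hir, hr]
      · have := h2 i (by simp [hi, hir])
        simp only [mem_union, mem_compl, mem_insert, mem_singleton] at this
        rintro hc
        rw [hc] at this
        have := hv.symm
        tauto
    have hiter : ∀ k, ∀ i ≠ v, (Function.update f v w)^[k] i = f^[k] i := by
      intro k
      induction k with
      | zero => simp
      | succ k ih =>
        intro i hi
        rw [Function.iterate_succ_apply, Function.iterate_succ_apply,
          Function.update_of_ne hi, ih _ (hleaf i hi)]
    have hreach : ∀ i ≠ v, ∃ k, (Function.update f v w)^[k] i = r := by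
      intro i hi
      by_cases hir : i = r
      · exact ⟨0, hir⟩
      · obtain ⟨k, hk⟩ := h3 i (by simp [hi, hir])
        exact ⟨k, by simpa [hiter k i hi] using hk⟩
    refine mem_filter.2 ⟨mem_univ _, ⟨?_, fun i => ?_⟩, hv, fun i hi => ?_⟩
    · simpa [Function.update_of_ne hv] using hr
    · by_cases hi : i = v
      · obtain ⟨k, hk⟩ := hreach w hw
        exact ⟨k + 1, by simpa [Function.iterate_succ_apply, hi] using hk⟩
      · exact hreach i hi
    · simpa [Function.update_of_ne hi] using hleaf i hi
  · intro f _
    simp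
  · rintro ⟨w, f⟩ hp
    have := (mem_rootedForests.1 (mem_product.1 hp).2).1 v (by simp)
    simpa using this.symm

theorem ncard_Bn {m : ℕ} (hm : 0 < m) (v : Fin (m + 1)) : (Bn (m + 1) v).ncard = m ^ m := by
  classical
  have hv : #{par | (par, v) ∈ Bn (m + 1) v} = 0 := by
    rw [card_eq_zero, filter_eq_empty_iff]
    exact fun par _ h => h.2.1 rfl
  rw [ncard_eq_sum_card_filter, ← sum_compl_add_sum {v}, sum_singleton, hv, add_zero,
    sum_congr rfl fun r hr => card_isRootedTree_leaf (by simpa using hr), sum_const, card_compl,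
    card_singleton, Fintype.card_fin, Nat.add_sub_cancel, smul_eq_mul, mul_pow_sub_one hm.ne']

end Trees

/-- `|U_n| = |B_n| = (n−1)^{n−1}`. -/
theorem stmt11 (n : ℕ) (hn : 2 ≤ n) :
    (Un n).ncard = (n - 1) ^ (n - 1) ∧
    (Bn n ⟨0, by omega⟩).ncard = (n - 1) ^ (n - 1) := by
  obtain ⟨m, rfl⟩ : ∃ m, n = m + 1 := ⟨n - 1, by omega⟩
  exact ⟨ncard_Un (by omega), ncard_Bn (by omega) _⟩
end

section
/- For every integer n ≥ 3, the number of uprooted trees on [n] in which 1 and n are not adjacent is |U_n'| = (n−1)^{n−3}(n−2)^2. -/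
theorem Matrix.det_one_sub_of_isNilpotent {V K : Type*} [Fintype V] [DecidableEq V] [Field K]
    {N : Matrix V V K} (hN : IsNilpotent N) : (1 - N).det = 1 := by
  have h : N.charpoly = Polynomial.X ^ Fintype.card V :=
    sub_eq_zero.mp (Matrix.isNilpotent_charpoly_sub_pow_of_isNilpotent hN).eq_zero
  simpa [h] using (Matrix.eval_charpoly N 1).symm

/-- The matrix `1 - A` of a functional graph fixing `r`, with column `r` of `A` removed, has
determinant `1` if `f` is an in-tree rooted at `r` and `0` otherwise. -/
theorem det_parent {V : Type*} [Fintype V] [DecidableEq V] (f : V → V) {r : V} (hr : f r = r)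
    [Decidable (∀ i, ∃ k, f^[k] i = r)] :
    (Matrix.of fun i k => (if i = k then (1 : ℚ) else 0) - if f i = k ∧ k ≠ r then 1 else 0).det =
      if ∀ i, ∃ k, f^[k] i = r then 1 else 0 := by
  split_ifs with h
  · set N : Matrix V V ℚ := Matrix.of fun i k => if f i = k ∧ k ≠ r then 1 else 0 with hN
    have hpow : ∀ m i k, (N ^ (m + 1)) i k = if f^[m + 1] i = k ∧ k ≠ r then 1 else 0 := by
      intro m
      induction m with
      | zero => intro i k; simp [hN]
      | succ m ih =>
        intro i k
        rw [pow_succ', Matrix.mul_apply, Finset.sum_eq_single (f i)]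
        · rw [ih, Function.iterate_succ_apply f (m + 1)]
          by_cases hi : f i = r
          · have : f^[m + 1] r = r := Function.iterate_fixed hr _
            simp only [hN, Matrix.of_apply, hi, this]
            grind
          · simp [hN, hi]
        · intro b _ hb
          simp [hN, hb.symm]
        · simp
    choose d hd using h
    have hnil : IsNilpotent N := by
      refine ⟨Finset.univ.sup d + 1, ?_⟩
      ext i k
      rw [hpow]
      have hle : d i ≤ Finset.univ.sup d + 1 :=
        (Finset.le_sup (f := d) (Finset.mem_univ i)).trans (Nat.le_succ _)
      obtain ⟨c, hc⟩ := Nat.exists_eq_add_of_le' hle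
      have : f^[Finset.univ.sup d + 1] i = r := by
        rw [hc, Function.iterate_add_apply, hd, Function.iterate_fixed hr]
      simp only [this, Matrix.zero_apply]
      grind
    refine Eq.trans ?_ (Matrix.det_one_sub_of_isNilpotent hnil)
    congr 1
  · push Not at h
    obtain ⟨a, ha⟩ := h
    classical
    refine Matrix.exists_mulVec_eq_zero_iff.mp
      ⟨fun i => if ∃ k, f^[k] i = r then 0 else 1, fun h0 => ?_, ?_⟩
    · have := congrFun h0 a
      simp [ha] at this
    · ext i
      have hiff : (∃ k, f^[k] (f i) = r) ↔ ∃ k, f^[k] i = r := by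
        constructor
        · rintro ⟨k, hk⟩
          exact ⟨k + 1, hk⟩
        · rintro ⟨k, hk⟩
          refine ⟨k, ?_⟩
          rw [← Function.iterate_succ_apply, Function.iterate_succ_apply', hk, hr]
      simp only [Matrix.mulVec, dotProduct, Matrix.of_apply, sub_mul, Finset.sum_sub_distrib,
        Pi.zero_apply]
      rw [Finset.sum_eq_single i, Finset.sum_eq_single (f i)]
      · simp only [hiff, if_true, one_mul, true_and]
        by_cases hi : f i = r
        · have : ∃ k, f^[k] i = r := ⟨1, hi⟩
          simp [this]
        · simp [hi]
      all_goals grind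

/-- The directed matrix-tree theorem, for in-trees rooted at `r`. -/
theorem det_laplacian_eq_sum {V : Type*} [Fintype V] [DecidableEq V] (w : V → V → ℚ) {r : V}
    (hw : ∀ j, j ≠ r → w r j = 0) [∀ f : V → V, Decidable (∀ i, ∃ k, f^[k] i = r)] :
    (Matrix.of fun i k => (if i = k then ∑ j, w i j else 0) - if k ≠ r then w i k else 0).det =
      ∑ f : V → V, (∏ i, w i (f i)) * if ∀ i, ∃ k, f^[k] i = r then 1 else 0 := by
  have hrow : (Matrix.of fun i k => (if i = k then ∑ j, w i j else 0) - if k ≠ r then w i k else 0)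
      = (fun i => ∑ j, w i j • fun k : V =>
          (if i = k then (1 : ℚ) else 0) - if j = k ∧ k ≠ r then 1 else 0 : Matrix V V ℚ) := by
    ext i k
    simp only [Matrix.of_apply, Finset.sum_apply, Pi.smul_apply, smul_eq_mul, mul_sub,
      Finset.sum_sub_distrib]
    by_cases h1 : i = k <;> by_cases h2 : k = r <;> simp [h1, h2]
  rw [hrow]
  refine ((Matrix.detRowAlternating (n := V) (R := ℚ)).toMultilinearMap.map_sum _).trans ?_
  refine Finset.sum_congr rfl fun f _ => ?_
  rw [MultilinearMap.map_smul_univ, smul_eq_mul]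
  by_cases hr : f r = r
  · congr 1
    exact det_parent f hr
  · rw [Finset.prod_eq_zero (Finset.mem_univ r) (by rw [hw]; exact hr), zero_mul, zero_mul]

/-- The determinant of a diagonal matrix perturbed by `-uuᵀ`. -/
theorem det_diagonal_sub_rankOne {V : Type*} [Fintype V] [DecidableEq V] (d u : V → ℚ)
    (hd : ∀ i, d i ≠ 0) :
    (Matrix.of fun i k => (if i = k then d i else 0) - u i * u k).det =
      (∏ i, d i) * (1 - ∑ i, u i ^ 2 / d i) := by
  have hM : (Matrix.of fun i k => (if i = k then d i else 0) - u i * u k) = Matrix.diagonal d *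
      (1 + (Matrix.of fun i (_ : Fin 1) => u i / d i) * Matrix.of fun (_ : Fin 1) k => -u k) := by
    ext i k
    have := hd i
    rw [Matrix.diagonal_mul]
    simp only [Matrix.add_apply, Matrix.mul_apply, Fin.sum_univ_one,
      Matrix.of_apply, Matrix.one_apply]
    split_ifs <;> field_simp <;> ring
  rw [hM, Matrix.det_mul, Matrix.det_diagonal, Matrix.det_one_add_mul_comm, Matrix.det_fin_one]
  congr 1
  simp only [Matrix.add_apply, Matrix.mul_apply, Matrix.of_apply, Matrix.one_apply_eq,
    sub_eq_add_neg, ← Finset.sum_neg_distrib]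
  congr 1
  refine Finset.sum_congr rfl fun i _ => ?_
  ring

/-- The determinant of a diagonal matrix perturbed by `-uuᵀ` and by two symmetric off-diagonal
entries. -/
theorem det_diagonal_sub_rankOne_add {V : Type*} [Fintype V] [DecidableEq V] (d u : V → ℚ)
    (hd : ∀ i, d i ≠ 0) {a b : V} (hab : a ≠ b) (ha : u a = 1) (hb : u b = 1) :
    (Matrix.of fun i k => (if i = k then d i else 0) - u i * u k
      + (if i = a ∧ k = b then 1 else 0) + if i = b ∧ k = a then 1 else 0).det =
      (∏ i, d i) * ((1 - ∑ i, u i ^ 2 / d i) * (1 - 1 / (d a * d b))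
        + (2 - 1 / d a - 1 / d b) / (d a * d b)) := by
  set A : Matrix V (Fin 3) ℚ := Matrix.of fun i =>
    ![u i / d i, if i = a then 1 / d i else 0, if i = b then 1 / d i else 0] with hA
  set B : Matrix (Fin 3) V ℚ := Matrix.of
    ![fun k => -u k, fun k => if k = b then 1 else 0, fun k => if k = a then 1 else 0] with hB
  have hM : (Matrix.of fun i k => (if i = k then d i else 0) - u i * u k
      + (if i = a ∧ k = b then 1 else 0) + if i = b ∧ k = a then 1 else 0) =
      Matrix.diagonal d * (1 + A * B) := by
    ext i k
    have := hd i
    rw [Matrix.diagonal_mul]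
    simp only [Matrix.add_apply, Matrix.mul_apply, Fin.sum_univ_three,
      Matrix.of_apply, Matrix.one_apply, hA, hB, Matrix.cons_val, ite_and]
    split_ifs <;> field_simp <;> ring
  have hBA : 1 + B * A = !![1 - ∑ i, u i ^ 2 / d i, -(1 / d a), -(1 / d b);
      1 / d b, 1, 1 / d b; 1 / d a, 1 / d a, 1] := by
    ext i j
    rw [Matrix.add_apply, Matrix.mul_apply]
    fin_cases i <;> fin_cases j <;>
      simp [hA, hB, ha, hb, hab, hab.symm, sub_eq_add_neg]
    refine Finset.sum_congr rfl fun i _ => ?_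
    ring
  rw [hM, Matrix.det_mul, Matrix.det_diagonal, Matrix.det_one_add_mul_comm, hBA,
    Matrix.det_fin_three]
  congr 1
  have := hd a
  have := hd b
  simp only [Matrix.of_apply, Matrix.cons_val', Matrix.cons_val]
  field_simp
  ring

/-- The edge condition `i → j` in uprooted trees with root `r` in which `a`, `b` are not
adjacent. -/
def UprootedEdge {n : ℕ} (a b r i j : Fin n) : Prop :=
  (i = r → j = r) ∧ (j = r → i ≠ r → i < r) ∧ ¬(i = a ∧ j = b) ∧ ¬(i = b ∧ j = a)

instance {n : ℕ} (a b r i j : Fin n) : Decidable (UprootedEdge a b r i j) := by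
  unfold UprootedEdge
  infer_instance

open Classical in
theorem ncard_Unp_eq_sum_det {n : ℕ} (a b : Fin n) :
    ((Unp n a b).ncard : ℚ) = ∑ r, (Matrix.of fun i k =>
      (if i = k then (Finset.card {j | UprootedEdge a b r i j} : ℚ) else 0) -
        if k ≠ r ∧ UprootedEdge a b r i k then 1 else 0).det := by
  have key (r : Fin n) : (Matrix.of fun i k =>
      (if i = k then (Finset.card {j | UprootedEdge a b r i j} : ℚ) else 0) -
        if k ≠ r ∧ UprootedEdge a b r i k then 1 else 0).det =
      ∑ f : Fin n → Fin n, if (f, r) ∈ Unp n a b then 1 else 0 := by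
    have := det_laplacian_eq_sum (fun i j => if UprootedEdge a b r i j then (1 : ℚ) else 0)
      (r := r) (by simp +contextual [UprootedEdge])
    simp only [Finset.sum_boole, ← ite_and] at this
    refine this.trans (Finset.sum_congr rfl fun f _ => ?_)
    have hiff : (f, r) ∈ Unp n a b ↔
        (∀ i, UprootedEdge a b r i (f i)) ∧ ∀ i, ∃ k, f^[k] i = r := by
      simp only [Unp, IsUprooted, IsRootedTree, UprootedEdge, Set.mem_ofPred_eq]
      grind
    rw [Fintype.prod_boole]
    by_cases h₁ : ∀ i, UprootedEdge a b r i (f i) <;> by_cases h₂ : ∀ i, ∃ k, f^[k] i = r <;>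
      simp [hiff, h₁, h₂]
  simp only [key]
  rw [Finset.sum_comm, ← Fintype.sum_prod_type', Finset.sum_boole, Set.ncard_eq_toFinset_card']
  congr 2
  ext x
  simp

theorem card_uprootedEdge_self {n : ℕ} (a b r : Fin n) (h : a ≠ b) :
    Finset.card {j | UprootedEdge a b r r j} = 1 := by
  rw [Finset.card_eq_one]
  refine ⟨r, ?_⟩
  ext j
  simp only [UprootedEdge, Finset.mem_filter, Finset.mem_univ, Finset.mem_singleton]
  grind

theorem card_uprootedEdge_of_compl {n : ℕ} {a b r i : Fin n} (s : Finset (Fin n))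
    (h : ∀ j, UprootedEdge a b r i j ↔ j ∉ s) :
    Finset.card {j | UprootedEdge a b r i j} = n - s.card := by
  have : ({j | UprootedEdge a b r i j} : Finset (Fin n)) = sᶜ := by
    ext j
    simp [h]
  rw [this, Finset.card_compl, Fintype.card_fin]

theorem det_uprooted_zero (N : ℕ) :
    (Matrix.of fun i k : Fin (N + 2) =>
      (if i = k then (Finset.card {j | UprootedEdge 0 (Fin.last _) 0 i j} : ℚ) else 0) -
        if k ≠ 0 ∧ UprootedEdge 0 (Fin.last _) 0 i k then 1 else 0).det = 0 := by
  have hd (i : Fin (N + 2)) : (Finset.card {j | UprootedEdge 0 (Fin.last _) 0 i j} : ℚ) =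
      (if i = 0 then 1 else N + 1 : ℚ) := by
    split_ifs with hi
    · rw [hi, card_uprootedEdge_self _ _ _ (Fin.last_pos).ne, Nat.cast_one]
    · rw [card_uprootedEdge_of_compl {0} (by simp only [UprootedEdge]; grind)]
      simp
  have hM := det_diagonal_sub_rankOne (fun i : Fin (N + 2) => if i = 0 then 1 else (N + 1 : ℚ))
    (fun i => if i = 0 then 0 else 1) (fun i => by split_ifs <;> positivity)
  simp only [hd]
  convert hM using 1
  · congr 1
    ext i k
    simp only [Matrix.of_apply, UprootedEdge]
    grind
  · have : (N : ℚ) + 1 ≠ 0 := by positivity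
    simp [Fin.sum_univ_succ, this]

theorem det_uprooted_last (N : ℕ) :
    (Matrix.of fun i k : Fin (N + 2) =>
      (if i = k then (Finset.card {j | UprootedEdge 0 (Fin.last _) (Fin.last _) i j} : ℚ) else 0) -
        if k ≠ Fin.last _ ∧ UprootedEdge 0 (Fin.last _) (Fin.last _) i k then 1 else 0).det =
      N * (N + 2 : ℚ) ^ N / (N + 2) := by
  have hd (i : Fin (N + 2)) :
      (Finset.card {j | UprootedEdge 0 (Fin.last _) (Fin.last _) i j} : ℚ) =
      (if i = Fin.last _ then 1 else if i = 0 then N + 1 else N + 2 : ℚ) := by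
    split_ifs with hi h0
    · rw [hi, card_uprootedEdge_self _ _ _ (Fin.last_pos).ne, Nat.cast_one]
    · rw [card_uprootedEdge_of_compl {Fin.last _} (by simp only [UprootedEdge]; grind)]
      simp
    · have := Fin.lt_last_iff_ne_last.mpr hi
      rw [card_uprootedEdge_of_compl ∅ (by simp only [UprootedEdge]; grind)]
      simp only [Finset.card_empty, Nat.sub_zero]
      push_cast
      ring
  have hM := det_diagonal_sub_rankOne
    (fun i : Fin (N + 2) => if i = Fin.last _ then 1 else if i = 0 then N + 1 else (N + 2 : ℚ))
    (fun i => if i = Fin.last _ then 0 else 1) (fun i => by split_ifs <;> positivity)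
  simp only [hd]
  convert hM using 1
  · congr 1
    ext i k
    simp only [Matrix.of_apply, UprootedEdge]
    have := fun hi => (Fin.lt_last_iff_ne_last (a := i)).mpr hi
    grind
  · rw [Fin.sum_univ_castSucc, Fin.sum_univ_succ, Fin.prod_univ_castSucc, Fin.prod_univ_succ]
    simp only [if_neg (Fin.castSucc_lt_last _).ne, if_neg Fin.last_pos.ne', Fin.castSucc_zero,
      if_neg Fin.last_pos.ne, if_pos, Fin.castSucc_eq_zero_iff, Fin.succ_ne_zero, if_false]
    simp
    field_simp
    ring

theorem det_uprooted_middle {N s t : ℕ} (hN : N = s + 1 + t) (r : Fin (N + 2))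
    (hr : r.val = s + 1) {n : ℚ} (hn : n = s + t + 3) :
    (Matrix.of fun i k : Fin (N + 2) =>
      (if i = k then (Finset.card {j | UprootedEdge 0 (Fin.last _) r i j} : ℚ) else 0) -
        if k ≠ r ∧ UprootedEdge 0 (Fin.last _) r i k then 1 else 0).det =
      n ^ s * (n - 1) ^ t * ((n ^ 2 - 3 * n + 1) * s / (n * (n - 1)) +
        (n ^ 2 - 3 * n + 1) / (n - 1) - (n - 2) ^ 2 / (n - 1)) := by
  subst hN
  have h0 : (0 : Fin (s + 1 + t + 2)) ≠ r := by simp [hr, Fin.ext_iff]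
  have hl : Fin.last _ ≠ r := by simp only [hr, ne_eq, Fin.ext_iff, Fin.val_last]; omega
  have h0l : (0 : Fin (s + 1 + t + 2)) ≠ Fin.last _ := Fin.last_pos.ne
  have hn₁ : n - 1 ≠ 0 := by rw [hn]; ring_nf; positivity
  have hn₂ : n - 2 ≠ 0 := by rw [hn]; ring_nf; positivity
  have hn₀ : n ≠ 0 := by rw [hn]; positivity
  have hcast : ((s + 1 + t + 2 : ℕ) : ℚ) = n := by rw [hn]; push_cast; ring
  let d : Fin (s + 1 + t + 2) → ℚ := fun i => if i = 0 then n - 1 else if i = Fin.last _ then n - 2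
    else if i.val < s + 1 then n else if i.val = s + 1 then 1 else n - 1
  have hd (i : Fin (s + 1 + t + 2)) :
      (Finset.card {j | UprootedEdge 0 (Fin.last _) r i j} : ℚ) = d i := by
    simp only [d]
    split_ifs with h₁ h₂ h₃ h₄
    · rw [card_uprootedEdge_of_compl {Fin.last _}
        (by simp only [UprootedEdge, Fin.lt_def, hr]; grind), Finset.card_singleton,
        Nat.cast_sub (by omega), hcast, Nat.cast_one]
    · have : r < i := by rw [h₂]; exact Fin.lt_last_iff_ne_last.mpr hl.symm
      rw [card_uprootedEdge_of_compl {0, r} (by simp only [UprootedEdge]; grind),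
        Finset.card_pair h0, Nat.cast_sub (by omega), hcast, Nat.cast_two]
    · have : i < r := by rwa [Fin.lt_def, hr]
      rw [card_uprootedEdge_of_compl ∅ (by simp only [UprootedEdge]; grind),
        Finset.card_empty, Nat.sub_zero, hcast]
    · have : i = r := Fin.ext (h₄.trans hr.symm)
      rw [this, card_uprootedEdge_self _ _ _ h0l, Nat.cast_one]
    · have : r < i := by rw [Fin.lt_def]; omega
      rw [card_uprootedEdge_of_compl {r} (by simp only [UprootedEdge]; grind),
        Finset.card_singleton, Nat.cast_sub (by omega), hcast, Nat.cast_one]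
  have hM := det_diagonal_sub_rankOne_add d (fun i => if i.val = s + 1 then 0 else 1)
    (fun i => by simp only [d]; split_ifs <;> first | assumption | exact one_ne_zero) h0l
    (by simp) (by simp only [Fin.val_last, ite_eq_right_iff]; omega)
  simp only [hd]
  have hd0 : d 0 = n - 1 := by simp [d]
  have hdl : d (Fin.last _) = n - 2 := by simp [d]
  have hdm (i : Fin (s + 1 + t)) : d i.succ.castSucc =
      if i.val < s then n else if i.val = s then 1 else n - 1 := by
    have h₁ : i.succ.castSucc ≠ Fin.last _ := (Fin.castSucc_lt_last _).ne
    have h₂ : i.succ.castSucc ≠ 0 := by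
      rw [ne_eq, Fin.castSucc_eq_zero_iff]
      exact Fin.succ_ne_zero i
    simp only [d, if_neg h₁, if_neg h₂]
    simp
  have hprod : ∏ i, d i = (n - 1) * (n ^ s * (n - 1) ^ t) * (n - 2) := by
    rw [Fin.prod_univ_castSucc, Fin.prod_univ_succ]
    simp only [Fin.castSucc_zero, ← Fin.succ_castSucc, hd0, hdl]
    simp only [Fin.succ_castSucc, hdm]
    congr 2
    rw [Fin.prod_univ_eq_prod_range (fun i => if i < s then n else if i = s then 1 else n - 1),
      Finset.prod_range_add, Finset.prod_range_succ]
    have : ∀ x ∈ Finset.range s, (if x < s then n else if x = s then 1 else n - 1) = n := by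
      grind
    rw [Finset.prod_congr rfl this]
    simp [add_assoc]
  have hsum : ∑ i : Fin (s + 1 + t + 2), (if i.val = s + 1 then (0 : ℚ) else 1) ^ 2 / d i =
      1 / (n - 1) + (s / n + t / (n - 1)) + 1 / (n - 2) := by
    rw [Fin.sum_univ_castSucc, Fin.sum_univ_succ]
    simp only [Fin.castSucc_zero, hd0, hdl, hdm]
    have hlast : (Fin.last (s + 1 + t + 1)).val ≠ s + 1 := by rw [Fin.val_last]; omega
    refine congrArg₂ (· + ·) (congrArg₂ (· + ·) (by simp) ?_) (by rw [if_neg hlast, one_pow])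
    simp only [Fin.val_castSucc, Fin.val_succ, Nat.add_right_cancel_iff]
    rw [Fin.sum_univ_eq_sum_range (fun i => (if i = s then (0 : ℚ) else 1) ^ 2 /
        if i < s then n else if i = s then 1 else n - 1),
      Finset.sum_range_add, Finset.sum_range_succ]
    have : ∀ x ∈ Finset.range s, (if x = s then (0 : ℚ) else 1) ^ 2 /
        (if x < s then n else if x = s then 1 else n - 1) = 1 / n := by
      grind
    rw [Finset.sum_congr rfl this]
    simp [add_assoc, div_eq_mul_inv]
  rw [hsum, hprod, hd0, hdl] at hM
  refine Eq.trans ?_ (hM.trans ?_)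
  · congr 1
    ext i k
    have hr' (i : Fin (s + 1 + t + 2)) : i.val = s + 1 ↔ i = r := by simp [hr, Fin.ext_iff]
    have := Fin.lt_last_iff_ne_last.mpr hl.symm
    simp only [Matrix.of_apply, UprootedEdge, hr']
    grind
  · have ht : (t : ℚ) = n - s - 3 := by rw [hn]; ring
    rw [ht]
    field_simp
    ring

/-- `|U_n'| = (n−1)^{n−3}(n−2)^2` for `n ≥ 3`. -/
theorem stmt13 (n : ℕ) (hn : 3 ≤ n) :
    (Unp n ⟨0, by omega⟩ ⟨n - 1, by omega⟩).ncard =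
      (n - 1) ^ (n - 3) * (n - 2) ^ 2 := by
  obtain ⟨N, rfl⟩ := Nat.exists_eq_add_of_le' (show 2 ≤ n by omega)
  obtain ⟨M, rfl⟩ := Nat.exists_eq_add_of_le' (show 1 ≤ N by omega)
  have h := ncard_Unp_eq_sum_det (0 : Fin (M + 1 + 2)) (Fin.last _)
  rw [Fin.sum_univ_castSucc, Fin.sum_univ_succ, Fin.castSucc_zero, det_uprooted_zero,
    det_uprooted_last] at h
  obtain ⟨n, hn⟩ : ∃ n : ℚ, n = M + 3 := ⟨_, rfl⟩
  have hn₁ : n - 1 ≠ 0 := by rw [hn]; ring_nf; positivity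
  have hn₀ : n ≠ 0 := by rw [hn]; positivity
  let B : ℕ → ℚ := fun s => n ^ s * (n - 1) ^ (M + 1 - s) *
    ((n ^ 2 - 3 * n + 1) * s / (n * (n - 1)) - (n - 2) ^ 2 / (n - 1))
  have hmid (x : Fin (M + 1)) : (Matrix.of fun i k : Fin (M + 1 + 2) =>
      (if i = k then (Finset.card {j | UprootedEdge 0 (Fin.last _) x.succ.castSucc i j} : ℚ)
        else 0) - if k ≠ x.succ.castSucc ∧ UprootedEdge 0 (Fin.last _) x.succ.castSucc i k
          then 1 else 0).det = B (x.val + 1) - B x.val := by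
    obtain ⟨t, ht⟩ := Nat.exists_eq_add_of_le (show x.val + 1 ≤ M + 1 by omega)
    have hM : (M : ℚ) = x.val + t := by
      exact_mod_cast (show M = x.val + t by omega)
    rw [det_uprooted_middle ht _ (by simp) (n := n) (by rw [hn, hM])]
    simp only [B, show M + 1 - (x.val + 1) = t by omega, show M + 1 - x.val = t + 1 by omega]
    push_cast
    field_simp
    ring
  rw [Finset.sum_congr rfl fun x _ => hmid x,
    Fin.sum_univ_eq_sum_range (fun x => B (x + 1) - B x), Finset.sum_range_sub] at h
  have hcast : ((Unp (M + 1 + 2) 0 (Fin.last _)).ncard : ℚ) = (M + 2) ^ M * (M + 1) ^ 2 := by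
    have hM : (M : ℚ) = n - 3 := by rw [hn]; ring
    rw [h]
    simp only [B, Nat.sub_self, Nat.sub_zero]
    push_cast
    simp only [hM]
    ring_nf at hn₁ ⊢
    field_simp
    ring
  have h_nat : (Unp (M + 1 + 2) 0 (Fin.last _)).ncard = (M + 2) ^ M * (M + 1) ^ 2 := by
    exact_mod_cast hcast
  exact h_nat
end
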